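/- For every ε > 0 there exists x₀ > 0 such that for all real x ≥ x₀, the number of fundamental discriminants D with 0 < D < x, D ≡ 1 (mod 3), and such that 3 does not divide the class number h(−D) of the imaginary quadratic field ℚ(√−D), is at least (1/2 − ε) times the number of fundamental discriminants D′ with −x < D′ < 0 and D′ ≡ 1 (mod 3). -/

import Mathlib

open scoped Real
open IntermediateField

/-- `D` is a fundamental discriminant. -/
def IsFundamentalDiscriminant (D : ℤ) : Prop :=
  (D % 4 = 1 ∧ Squarefree D) ∨
    ∃ m : ℤ, D = 4 * m ∧ Squarefree m ∧ (m % 4 = 2 ∨ m % 4 = 3)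

section

open Module NumberField

theorem exists_basis_zero_eq_one (K : Type*) [Field K] [NumberField K] (h2 : finrank ℚ K = 2) :
    ∃ b : Basis (Fin 2) ℤ (𝓞 K), b 0 = 1 := by
  have hr : finrank ℤ (𝓞 K) = 2 := by rw [RingOfIntegers.rank, h2]
  let b : Basis (Fin 2) ℤ (𝓞 K) := (finBasisOfFinrankEq ℤ (𝓞 K) hr)
  have h1 : (1 : 𝓞 K) = b.repr 1 0 • b 0 + b.repr 1 1 • b 1 := by
    conv_lhs => rw [← b.sum_repr 1]
    simp [Fin.sum_univ_two]
  set u := b.repr 1 0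
  set v := b.repr 1 1
  have hco : IsCoprime u v := by
    rw [Int.isCoprime_iff_gcd_eq_one]
    have hu : ((Int.gcd u v : ℤ)) ∣ u := Int.gcd_dvd_left ..
    have hv : ((Int.gcd u v : ℤ)) ∣ v := Int.gcd_dvd_right ..
    obtain ⟨u', hu'⟩ := hu
    obtain ⟨v', hv'⟩ := hv
    have : IsUnit (algebraMap ℤ (𝓞 K) (Int.gcd u v)) := by
      refine IsUnit.of_mul_eq_one (u' • b 0 + v' • b 1) ?_
      rw [← Algebra.smul_def, smul_add, smul_smul, smul_smul, ← hu', ← hv', ← h1]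
    have := isUnit_of_map_unit _ _ this
    exact_mod_cast Int.isUnit_iff_natAbs_eq.1 this
  obtain ⟨x, y, hxy⟩ := hco
  have hli : LinearIndependent ℤ ![(1 : 𝓞 K), -y • b 0 + x • b 1] := by
    rw [LinearIndependent.pair_iff]
    intro s t hst
    rw [h1] at hst
    have e : (s * u - t * y) • b 0 + (s * v + t * x) • b 1 = 0 := by
      rw [← hst]; module
    have := LinearIndependent.pair_iff.1 (by
      have := b.linearIndependent
      have h' : (b : Fin 2 → 𝓞 K) = ![b 0, b 1] := by ext i; fin_cases i <;> rfl
      rw [h'] at this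
      exact this) _ _ e
    obtain ⟨e1, e2⟩ := this
    constructor
    · linear_combination (-s) * hxy + x * e1 + y * e2
    · linear_combination (-t) * hxy + u * e2 - v * e1
  refine ⟨Basis.mk hli ?_, by simp⟩
  intro w _
  have hw : w = b.repr w 0 • b 0 + b.repr w 1 • b 1 := by
    conv_lhs => rw [← b.sum_repr w]
    simp [Fin.sum_univ_two]
  rw [Matrix.range_cons, Matrix.range_cons, Matrix.range_empty, Set.union_empty,
    Set.singleton_union, Submodule.mem_span_pair]
  refine ⟨x * b.repr w 0 + y * b.repr w 1, - v * b.repr w 0 + u * b.repr w 1, ?_⟩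
  conv_rhs => rw [hw]
  conv_lhs => rw [h1]
  have e1 : (x * b.repr w 0 + y * b.repr w 1) * u - (- v * b.repr w 0 + u * b.repr w 1) * y
    = b.repr w 0 := by linear_combination (b.repr w 0) * hxy
  have e2 : (x * b.repr w 0 + y * b.repr w 1) * v + (- v * b.repr w 0 + u * b.repr w 1) * x
    = b.repr w 1 := by linear_combination (b.repr w 1) * hxy
  conv_rhs => rw [← e1, ← e2]
  module

/-- The reduced discriminant of `a x³ + 3 b x² y + 3 c x y² + d y³` equals that of its Hessian. -/
def hessDisc {R : Type*} [CommRing R] (a b c d : R) : R :=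
  (b * c - a * d) ^ 2 - 4 * (b ^ 2 - a * c) * (c ^ 2 - b * d)

theorem hessDisc_mul_pow {R : Type*} [CommRing R] {a b c d u v w x w' x' g : R}
    (ha : a * g = u * w ^ 3 + v * w' ^ 3) (hb : b * g = u * w ^ 2 * x + v * w' ^ 2 * x')
    (hc : c * g = u * w * x ^ 2 + v * w' * x' ^ 2) (hd : d * g = u * x ^ 3 + v * x' ^ 3) :
    hessDisc a b c d * g ^ 4 = (u * v) ^ 2 * (w * x' - x * w') ^ 6 := by
  have : hessDisc a b c d * g ^ 4 = hessDisc (a * g) (b * g) (c * g) (d * g) := by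
    unfold hessDisc; ring
  rw [this, ha, hb, hc, hd]
  unfold hessDisc; ring

theorem Int.exists_eq_cube_of_sq_eq_cube {m : ℤ} {j : ℕ} (h : (j : ℤ) ^ 3 = m ^ 2) :
    ∃ k : ℤ, m = k ^ 3 := by
  rcases eq_or_ne j 0 with rfl | hj
  · refine ⟨0, ?_⟩
    have : m ^ 2 = 0 := by rw [← h]; simp
    simpa using this
  have hj' : (j : ℤ) ≠ 0 := by exact_mod_cast hj
  have h1 : (j : ℤ) ^ 2 ∣ m ^ 2 := ⟨j, by rw [← h]; ring⟩
  obtain ⟨k, rfl⟩ := (Int.pow_dvd_pow_iff two_ne_zero).1 h1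
  have h2 : (j : ℤ) = k ^ 2 := by
    have : (j : ℤ) ^ 2 * j = (j : ℤ) ^ 2 * k ^ 2 := by linear_combination h
    exact mul_left_cancel₀ (pow_ne_zero 2 hj') this
  exact ⟨k, by rw [h2]; ring⟩

open ComplexConjugate

section

variable {K : Type*} [Field K] [NumberField K]

theorem map_eq_of_basis (b : Basis (Fin 2) ℤ (𝓞 K)) (hb : b 0 = 1) (φ : K →+* ℂ) (x : 𝓞 K) :
    φ x = b.repr x 0 + b.repr x 1 * φ (b 1) := by
  conv_lhs => rw [← b.sum_repr x]
  simp [Fin.sum_univ_two, hb]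

theorem norm_eq_of_basis (b : Basis (Fin 2) ℤ (𝓞 K)) (hb : b 0 = 1) (φ : K →+* ℂ)
    (hz : φ (b 1) - conj (φ (b 1)) ≠ 0) (x : 𝓞 K) :
    ((Algebra.norm ℤ x : ℤ) : ℂ) = φ x * conj (φ x) := by
  rw [Algebra.norm_eq_matrix_det b, Matrix.det_fin_two]
  simp only [Algebra.leftMulMatrix_eq_repr_mul, hb, mul_one]
  have h1 := map_eq_of_basis b hb φ x
  have h2 := map_eq_of_basis b hb φ (x * b 1)
  have h1' := congrArg conj h1
  have h2' := congrArg conj h2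
  simp only [map_add, map_mul, map_intCast] at h1 h2 h1' h2'
  apply mul_right_cancel₀ hz
  push_cast
  linear_combination (-(b.repr (x * b 1) 0 + b.repr (x * b 1) 1 * φ (b 1))) * h1'
    - conj (φ x) * h2 + (b.repr (x * b 1) 0 + b.repr (x * b 1) 1 * conj (φ (b 1))) * h1 + φ x * h2'

theorem absNorm_eq_of_basis (b : Basis (Fin 2) ℤ (𝓞 K)) (hb : b 0 = 1) (φ : K →+* ℂ)
    (I : Ideal (𝓞 K)) (bI : Basis (Fin 2) ℤ I) : ∃ e : ℤ, e.natAbs = Ideal.absNorm I ∧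
    φ (bI 0 : 𝓞 K) * conj (φ (bI 1 : 𝓞 K)) - φ (bI 1 : 𝓞 K) * conj (φ (bI 0 : 𝓞 K))
      = - e * (φ (b 1) - conj (φ (b 1))) := by
  refine ⟨_, Ideal.natAbs_det_basis_change b I bI, ?_⟩
  rw [Basis.det_apply, Matrix.det_fin_two]
  rw [map_eq_of_basis b hb φ (bI 0 : 𝓞 K), map_eq_of_basis b hb φ (bI 1 : 𝓞 K)]
  simp [Basis.toMatrix_apply]
  ring

end

section

variable {K : Type*} [Field K] [NumberField K]

/-- If `I ^ 3` has a generator that, up to an integer factor, is the cube of a nonzero element of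
`I`, then `I` is principal. -/
theorem isPrincipal_of_pow_three_eq (b : Basis (Fin 2) ℤ (𝓞 K)) (hb : b 0 = 1) (φ : K →+* ℂ)
    (hz : φ (b 1) - conj (φ (b 1)) ≠ 0) {I : Ideal (𝓞 K)} (hI : I ≠ ⊥) {δ w : 𝓞 K}
    (hδ : I ^ 3 = Ideal.span {δ}) (hw : w ∈ I) (hw0 : w ≠ 0) {m : ℤ} (hm : w ^ 3 = δ * m) :
    I.IsPrincipal := by
  have hNorm : (Algebra.norm ℤ w) ^ 3 = m ^ 2 * Algebra.norm ℤ δ := by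
    have h1 := norm_eq_of_basis b hb φ hz w
    have h2 := norm_eq_of_basis b hb φ hz δ
    have h3 : φ w ^ 3 = φ δ * m := by
      have := congrArg (fun t : 𝓞 K => φ (t : K)) hm
      simpa using this
    have h4 := congrArg conj h3
    simp only [map_mul, map_pow, map_intCast] at h4
    have : ((Algebra.norm ℤ w : ℤ) : ℂ) ^ 3 = (m : ℂ) ^ 2 * ((Algebra.norm ℤ δ : ℤ) : ℂ) := by
      rw [h1, h2, mul_pow, h3, h4]; ring
    exact_mod_cast this
  obtain ⟨J, hJ⟩ := Ideal.dvd_span_singleton.2 hw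
  have hI0 : Ideal.absNorm I ≠ 0 := by rwa [Ne, Ideal.absNorm_eq_zero_iff]
  have hEδ : Ideal.absNorm I ^ 3 = (Algebra.norm ℤ δ).natAbs := by
    rw [← map_pow, hδ, Ideal.absNorm_span_singleton]
  have hEw : Ideal.absNorm I * Ideal.absNorm J = (Algebra.norm ℤ w).natAbs := by
    rw [← map_mul, ← hJ, Ideal.absNorm_span_singleton]
  have hj : Ideal.absNorm J ^ 3 = m.natAbs ^ 2 := by
    have h := congrArg Int.natAbs hNorm
    rw [Int.natAbs_pow, Int.natAbs_mul, Int.natAbs_pow, ← hEδ, ← hEw, mul_pow] at h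
    refine mul_left_cancel₀ (pow_ne_zero 3 hI0) (h.trans (mul_comm _ _))
  obtain ⟨k, rfl⟩ := Int.exists_eq_cube_of_sq_eq_cube (m := m) (j := Ideal.absNorm J) (by
    rw [← Int.natAbs_sq]; exact_mod_cast hj)
  have hk : (k : 𝓞 K) ≠ 0 := by
    rintro h0
    apply hw0
    have : w ^ 3 = 0 := by rw [hm]; push_cast; rw [h0]; ring
    simpa using this
  have hJk : J = Ideal.span {(k : 𝓞 K)} := by
    apply pow_left_injective three_ne_zero
    apply mul_left_cancel₀ (pow_ne_zero 3 hI)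
    change I ^ 3 * J ^ 3 = I ^ 3 * Ideal.span {(k : 𝓞 K)} ^ 3
    rw [← mul_pow, ← hJ, hδ, Ideal.span_singleton_pow, Ideal.span_singleton_pow, hm,
      Ideal.span_singleton_mul_span_singleton]
    push_cast; rfl
  have hwk : w ∈ Ideal.span {(k : 𝓞 K)} :=
    Ideal.dvd_span_singleton.1 ⟨I, by rw [hJ, hJk, mul_comm]⟩
  obtain ⟨η, hη⟩ := Ideal.mem_span_singleton'.1 hwk
  have hk' : Ideal.span {(k : 𝓞 K)} ≠ 0 := by simpa using hk
  have hIη : I = Ideal.span {η} := by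
    apply mul_right_cancel₀ hk'
    rw [Ideal.span_singleton_mul_span_singleton, hη, hJ, hJk]
  exact ⟨⟨η, hIη⟩⟩

theorem exists_cubic_form (b : Basis (Fin 2) ℤ (𝓞 K)) (hb : b 0 = 1) (φ : K →+* ℂ)
    (hz : φ (b 1) - conj (φ (b 1)) ≠ 0) (h3 : 3 ∣ classNumber K) :
    ∃ a₀ a₁ a₂ a₃ : ℤ, ((hessDisc a₀ a₁ a₂ a₃ : ℤ) : ℂ) = (φ (b 1) - conj (φ (b 1))) ^ 2 ∧
      ∀ x y : ℤ, a₀ * x ^ 3 + 3 * a₁ * x ^ 2 * y + 3 * a₂ * x * y ^ 2 + a₃ * y ^ 3 = 0 →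
        x = 0 ∧ y = 0 := by
  have : Fact (Nat.Prime 3) := ⟨Nat.prime_three⟩
  obtain ⟨g, hg⟩ := exists_prime_orderOf_dvd_card (G := ClassGroup (𝓞 K)) 3 h3
  obtain ⟨⟨I, hI⟩, rfl⟩ := ClassGroup.mk0_surjective g
  have hI0 : I ≠ ⊥ := by simpa using nonZeroDivisors.ne_zero hI
  have hnp : ¬ I.IsPrincipal := by
    intro h
    rw [(ClassGroup.mk0_eq_one_iff hI).2 h, orderOf_one] at hg
    norm_num at hg
  have hp3 : (I ^ 3).IsPrincipal := by
    have h := pow_orderOf_eq_one (ClassGroup.mk0 ⟨I, hI⟩)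
    rw [hg, ← map_pow] at h
    exact (ClassGroup.mk0_eq_one_iff (pow_mem hI 3)).1 h
  obtain ⟨⟨δ, hδ⟩⟩ := hp3
  change I ^ 3 = Ideal.span {δ} at hδ
  have hδ0 : δ ≠ 0 := by
    rintro rfl
    apply pow_ne_zero 3 hI0
    rw [hδ]; simp
  let bI := I.selfBasis b hI0
  obtain ⟨e, heI, he⟩ := absNorm_eq_of_basis b hb φ I bI
  obtain ⟨w₁, hw₁⟩ : ∃ w, w = (bI 0 : 𝓞 K) := ⟨_, rfl⟩
  obtain ⟨w₂, hw₂⟩ : ∃ w, w = (bI 1 : 𝓞 K) := ⟨_, rfl⟩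
  rw [← hw₁, ← hw₂] at he
  have hw₁I : w₁ ∈ I := hw₁ ▸ (bI 0).2
  have hw₂I : w₂ ∈ I := hw₂ ▸ (bI 1).2
  have key : ∀ u v w : 𝓞 K, u ∈ I → v ∈ I → w ∈ I → ∃ x : 𝓞 K, u * v * w = δ * x := by
    intro u v w hu hv hw
    have : u * v * w ∈ I ^ 3 := by
      rw [pow_three']
      exact Ideal.mul_mem_mul (Ideal.mul_mem_mul hu hv) hw
    rw [hδ, Ideal.mem_span_singleton] at this
    exact this
  obtain ⟨α₀, h₀⟩ := key _ _ _ hw₁I hw₁I hw₁I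
  obtain ⟨α₁, h₁⟩ := key _ _ _ hw₁I hw₁I hw₂I
  obtain ⟨α₂, h₂⟩ := key _ _ _ hw₁I hw₂I hw₂I
  obtain ⟨α₃, h₃⟩ := key _ _ _ hw₂I hw₂I hw₂I
  refine ⟨b.repr α₀ 1, b.repr α₁ 1, b.repr α₂ 1, b.repr α₃ 1, ?_, ?_⟩
  · have hδφ : φ δ ≠ 0 := by simpa using hδ0
    have hδφ' : conj (φ δ) ≠ 0 := by simpa using hδ0
    have coord : ∀ x : 𝓞 K, (b.repr x 1 : ℂ) * (φ (b 1) - conj (φ (b 1))) = φ x - conj (φ x) := by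
      intro x
      rw [map_eq_of_basis b hb φ x]
      simp only [map_add, map_mul, map_intCast]
      ring
    have main : ∀ u v w x : 𝓞 K, u * v * w = δ * x →
        (b.repr x 1 : ℂ) * (φ (b 1) - conj (φ (b 1))) = (φ δ)⁻¹ * (φ u * φ v * φ w)
          + (-(conj (φ δ))⁻¹) * (conj (φ u) * conj (φ v) * conj (φ w)) := by
      intro u v w x h
      have h' : φ u * φ v * φ w = φ δ * φ x := by
        have := congrArg (fun t : 𝓞 K => φ (t : K)) h
        simpa using this
      have h'' := congrArg conj h'
      simp only [map_mul] at h''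
      rw [h', h'', coord]
      field_simp
      ring
    have hd := hessDisc_mul_pow (a := (b.repr α₀ 1 : ℂ)) (b := (b.repr α₁ 1 : ℂ))
      (c := (b.repr α₂ 1 : ℂ)) (d := (b.repr α₃ 1 : ℂ)) (u := (φ δ)⁻¹) (v := -(conj (φ δ))⁻¹)
      (w := φ w₁) (x := φ w₂) (w' := conj (φ w₁)) (x' := conj (φ w₂))
      ((main _ _ _ _ h₀).trans (by ring)) ((main _ _ _ _ h₁).trans (by ring))
      ((main _ _ _ _ h₂).trans (by ring)) ((main _ _ _ _ h₃).trans (by ring))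
    have hN : (φ δ * conj (φ δ)) ^ 2 = (e : ℂ) ^ 6 := by
      rw [← norm_eq_of_basis b hb φ hz δ]
      have : (Algebra.norm ℤ δ).natAbs = e.natAbs ^ 3 := by
        rw [heI, ← map_pow, hδ, Ideal.absNorm_span_singleton]
      have h2 : (Algebra.norm ℤ δ) ^ 2 = e ^ 6 := by
        rw [← Int.natAbs_sq, this]
        push_cast
        rw [← pow_mul, ← abs_pow, abs_of_nonneg (Even.pow_nonneg (by decide) e)]
      exact_mod_cast h2
    rw [he] at hd
    apply mul_right_cancel₀ (pow_ne_zero 4 hz)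
    have hcast : ((hessDisc (b.repr α₀ 1) (b.repr α₁ 1) (b.repr α₂ 1) (b.repr α₃ 1) : ℤ) : ℂ) =
        hessDisc (b.repr α₀ 1 : ℂ) (b.repr α₁ 1 : ℂ) (b.repr α₂ 1 : ℂ) (b.repr α₃ 1 : ℂ) := by
      simp [hessDisc]
    rw [hcast, hd]
    have he0 : (e : ℂ) ^ 6 ≠ 0 := by
      rw [← hN]; exact pow_ne_zero 2 (mul_ne_zero hδφ hδφ')
    have : ((φ δ)⁻¹ * -(conj (φ δ))⁻¹) ^ 2 = ((e : ℂ) ^ 6)⁻¹ := by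
      rw [← hN]; field_simp
    have he1 : (e : ℂ) ≠ 0 := fun h => he0 (by rw [h]; simp)
    rw [this, mul_pow, neg_pow]
    field_simp
  · intro x y hxy
    set w : 𝓞 K := x * w₁ + y * w₂ with hw
    have hwI : w ∈ I := I.add_mem (I.mul_mem_left _ hw₁I) (I.mul_mem_left _ hw₂I)
    have hw3 : w ^ 3 = δ * (x ^ 3 • α₀ + (3 * x ^ 2 * y) • α₁ + (3 * x * y ^ 2) • α₂
        + y ^ 3 • α₃) := by
      simp only [zsmul_eq_mul]
      push_cast
      linear_combination (x : 𝓞 K) ^ 3 * h₀ + (3 * (x : 𝓞 K) ^ 2 * y) * h₁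
        + (3 * (x : 𝓞 K) * y ^ 2) * h₂ + (y : 𝓞 K) ^ 3 * h₃
    obtain ⟨β, hβ⟩ : ∃ β, β = x ^ 3 • α₀ + (3 * x ^ 2 * y) • α₁ + (3 * x * y ^ 2) • α₂
        + y ^ 3 • α₃ := ⟨_, rfl⟩
    rw [← hβ] at hw3
    have hβ1 : b.repr β 1 = 0 := by
      rw [← hxy, hβ]
      simp only [map_add, map_zsmul, Finsupp.add_apply, Finsupp.smul_apply, smul_eq_mul]
      ring
    have hβ0 : β = ((b.repr β 0 : ℤ) : 𝓞 K) := by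
      conv_lhs => rw [← b.sum_repr β]
      simp [Fin.sum_univ_two, hb, hβ1]
    rw [hβ0] at hw3
    by_cases hw0 : w = 0
    · have hli : LinearIndependent ℤ ![w₁, w₂] := by
        have h := bI.linearIndependent.map' (I.subtype.restrictScalars ℤ)
          (LinearMap.ker_eq_bot.2 Subtype.val_injective)
        have h' : ⇑(I.subtype.restrictScalars ℤ) ∘ bI = ![w₁, w₂] := by
          ext i; fin_cases i <;> simp [hw₁, hw₂]
        rwa [h'] at h
      refine LinearIndependent.pair_iff.1 hli x y ?_
      rw [zsmul_eq_mul, zsmul_eq_mul, ← hw, hw0]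
    · exact absurd (isPrincipal_of_pow_three_eq b hb φ hz hI0 hδ hwI hw0 hw3) hnp

end

open IntermediateField in
theorem finrank_adjoin_sqrt_neg {c : ℂ} {D : ℤ} (hD : 0 < D) (hc : c ^ 2 = -(D : ℂ)) :
    Module.finrank ℚ ℚ⟮c⟯ = 2 := by
  have hroot : Polynomial.aeval c (Polynomial.X ^ 2 + Polynomial.C (D : ℚ)) = 0 := by
    simp [hc]
  have hmonic : (Polynomial.X ^ 2 + Polynomial.C (D : ℚ)).Monic := by monicity!
  have hdeg : (Polynomial.X ^ 2 + Polynomial.C (D : ℚ)).natDegree = 2 := by compute_degree!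
  have hirr : Irreducible (Polynomial.X ^ 2 + Polynomial.C (D : ℚ)) := by
    refine (Polynomial.irreducible_iff_roots_eq_zero_of_degree_le_three (by omega) (by omega)).2 ?_
    rw [Multiset.eq_zero_iff_forall_notMem]
    intro x hx
    have := (Polynomial.mem_roots'.1 hx).2
    simp only [Polynomial.IsRoot.def, Polynomial.eval_add, Polynomial.eval_pow, Polynomial.eval_X,
      Polynomial.eval_C] at this
    have hD' : (0 : ℚ) < D := by exact_mod_cast hD
    nlinarith [sq_nonneg x]
  have hci : IsIntegral ℚ c := ⟨_, hmonic, by simpa [Polynomial.aeval_def] using hroot⟩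
  rw [IntermediateField.adjoin.finrank hci,
    ← minpoly.eq_of_irreducible_of_monic hirr hroot hmonic, hdeg]

theorem Int.eq_neg_four_mul_of_sq_mul_eq {N m E : ℤ} (hN : Squarefree N)
    (hN4 : N % 4 = 1 ∨ N % 4 = 2) (hE : E % 4 = 0 ∨ E % 4 = 1) (h : -4 * N = m ^ 2 * E) :
    E = -4 * N := by
  rcases Int.even_or_odd m with ⟨k, rfl⟩ | hm
  · exfalso
    have h' : -N = k ^ 2 * E := by linarith
    have hk : IsUnit k := hN k ⟨-E, by linarith⟩
    have : k ^ 2 = 1 := by rcases Int.isUnit_iff.1 hk with rfl | rfl <;> norm_num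
    rw [this] at h'
    omega
  · have hco : IsCoprime (m * m) 4 := by
      have h2 : IsCoprime m 2 := Int.isCoprime_iff_gcd_eq_one.2 (by
        rw [Int.gcd_comm]; exact (Int.isCoprime_iff_gcd_eq_one.1 (Int.prime_two.coprime_iff_not_dvd.2
          (by rw [← even_iff_two_dvd]; exact Int.not_even_iff_odd.2 hm))))
      have := (h2.mul_right h2)
      exact (this.mul_left this)
    have hdvd : m * m ∣ N := by
      refine hco.dvd_of_dvd_mul_left (y := 4) ⟨-E, by linarith⟩
    have hu := hN m hdvd
    have : m ^ 2 = 1 := by rcases Int.isUnit_iff.1 hu with rfl | rfl <;> norm_num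
    rw [this] at h
    linarith

theorem hessDisc_emod_four (a b c d : ℤ) :
    hessDisc a b c d % 4 = 0 ∨ hessDisc a b c d % 4 = 1 := by
  unfold hessDisc
  have h : ∀ x y : ℤ, (x ^ 2 - 4 * y) % 4 = 0 ∨ (x ^ 2 - 4 * y) % 4 = 1 := by
    intro x y
    rcases Int.even_or_odd x with ⟨k, rfl⟩ | ⟨k, rfl⟩
    · left; ring_nf; omega
    · right; ring_nf; omega
  have := h (b * c - a * d) ((b ^ 2 - a * c) * (c ^ 2 - b * d))
  rwa [← mul_assoc] at this

/-- The absolute value of the discriminant of `ℚ(√-N)` for squarefree `N > 0`. -/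
def absDisc (N : ℤ) : ℤ := if N % 4 = 3 then N else 4 * N

open IntermediateField NumberField in
theorem exists_cubic_form_of_sqrt {c : ℂ} {D N : ℤ} (hN0 : 0 < N) (hN : Squarefree N)
    (hDN : D = N ∨ D = 4 * N) (hc : c ^ 2 = -(D : ℂ)) [NumberField ℚ⟮c⟯]
    (h3 : 3 ∣ classNumber ℚ⟮c⟯) :
    ∃ a₀ a₁ a₂ a₃ : ℤ, hessDisc a₀ a₁ a₂ a₃ = - absDisc N ∧
      ∀ x y : ℤ, a₀ * x ^ 3 + 3 * a₁ * x ^ 2 * y + 3 * a₂ * x * y ^ 2 + a₃ * y ^ 3 = 0 →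
        x = 0 ∧ y = 0 := by
  have hD0 : 0 < D := by rcases hDN with h | h <;> omega
  obtain ⟨b, hb⟩ := exists_basis_zero_eq_one ℚ⟮c⟯ (finrank_adjoin_sqrt_neg hD0 hc)
  let φ : ℚ⟮c⟯ →+* ℂ := algebraMap ℚ⟮c⟯ ℂ
  obtain ⟨s, hs⟩ : ∃ s : ℚ⟮c⟯, s ^ 2 = -(N : ℚ⟮c⟯) := by
    have hg : (AdjoinSimple.gen ℚ c) ^ 2 = -(D : ℚ⟮c⟯) := by
      apply (algebraMap ℚ⟮c⟯ ℂ).injective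
      simp [hc]
    rcases hDN with rfl | rfl
    · exact ⟨_, hg⟩
    · refine ⟨AdjoinSimple.gen ℚ c / 2, ?_⟩
      rw [div_pow, hg]; push_cast; ring
  have hφs : (φ s) ^ 2 = -(N : ℂ) := by rw [← map_pow, hs]; simp
  have hre : conj (φ s) = - φ s := by
    have h2 : (conj (φ s) - φ s) * (conj (φ s) + φ s) = 0 := by
      have := congrArg conj hφs
      simp only [map_pow, map_neg, map_intCast] at this
      linear_combination this - hφs
    rcases mul_eq_zero.1 h2 with h | h
    · exfalso
      obtain ⟨r, hr⟩ := Complex.conj_eq_iff_real.1 (sub_eq_zero.1 h)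
      rw [hr] at hφs
      have hN' : (0 : ℝ) < N := by exact_mod_cast hN0
      have : r ^ 2 = -(N : ℝ) := by exact_mod_cast hφs
      nlinarith [sq_nonneg r]
    · linear_combination h
  have hφs0 : φ s ≠ 0 := by
    intro h; rw [h] at hφs
    have : (N : ℂ) = 0 := by linear_combination hφs
    have : N = 0 := by exact_mod_cast this
    omega
  have coord : ∀ x : 𝓞 ℚ⟮c⟯, φ x - conj (φ x) = b.repr x 1 * (φ (b 1) - conj (φ (b 1))) := by
    intro x
    rw [map_eq_of_basis b hb φ x]
    simp only [map_add, map_mul, map_intCast]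
    ring
  have hsint : IsIntegral ℤ s := by
    refine ⟨Polynomial.X ^ 2 + Polynomial.C N, by monicity!, ?_⟩
    rw [Polynomial.eval₂_add, Polynomial.eval₂_pow, Polynomial.eval₂_X, Polynomial.eval₂_C, hs]
    simp
  have hsx := coord ⟨s, hsint⟩
  change φ s - conj (φ s) = _ at hsx
  have hz : φ (b 1) - conj (φ (b 1)) ≠ 0 := by
    intro h
    rw [h, hre, mul_zero] at hsx
    apply hφs0; linear_combination hsx / 2
  obtain ⟨a₀, a₁, a₂, a₃, hE, hnv⟩ := exists_cubic_form b hb φ hz h3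
  refine ⟨a₀, a₁, a₂, a₃, ?_, hnv⟩
  have hE4 := hessDisc_emod_four a₀ a₁ a₂ a₃
  set E := hessDisc a₀ a₁ a₂ a₃
  have hN4 : N % 4 ≠ 0 := by
    intro h
    have := hN 2 (by omega)
    rw [Int.isUnit_iff] at this
    omega
  unfold absDisc
  split_ifs with hN3
  · have hαint : IsIntegral ℤ ((1 + s) / 2) := by
      obtain ⟨k, hk⟩ : ∃ k, N = 4 * k + 3 := ⟨N / 4, by omega⟩
      refine ⟨Polynomial.X ^ 2 - Polynomial.X + Polynomial.C (k + 1), by monicity!, ?_⟩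
      simp only [Polynomial.eval₂_add, Polynomial.eval₂_sub, Polynomial.eval₂_pow,
        Polynomial.eval₂_X, Polynomial.eval₂_C]
      simp only [map_add, map_one, algebraMap_int_eq, eq_intCast]
      rw [hk] at hs
      push_cast at hs
      linear_combination hs / 4
    have hα := coord ⟨_, hαint⟩
    change φ ((1 + s) / 2) - conj (φ ((1 + s) / 2)) = _ at hα
    set m := b.repr ⟨_, hαint⟩ 1
    have h : -(N : ℂ) = (m : ℂ) ^ 2 * (E : ℂ) := by
      rw [hE, ← mul_pow, ← hα]
      simp only [map_div₀, map_add, map_one, map_ofNat, hre]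
      rw [← hφs]; ring
    have h' : -N = m ^ 2 * E := by exact_mod_cast h
    have hm := hN m ⟨-E, by linarith⟩
    have : m ^ 2 = 1 := by rcases Int.isUnit_iff.1 hm with h | h <;> rw [h] <;> norm_num
    rw [this] at h'
    linarith
  · set m := b.repr ⟨s, hsint⟩ 1
    have h : -4 * (N : ℂ) = (m : ℂ) ^ 2 * (E : ℂ) := by
      rw [hE, ← mul_pow, ← hsx, hre]
      linear_combination -4 * hφs
    have h' : -4 * N = m ^ 2 * E := by exact_mod_cast h
    rw [Int.eq_neg_four_mul_of_sq_mul_eq hN (by omega) hE4 h']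
    ring

theorem exists_reduced_of_cubic_form (s : ℕ) : ∀ a b c d : ℤ,
    hessDisc a b c d < 0 → (b ^ 2 - a * c + (c ^ 2 - b * d)).toNat ≤ s →
    (∀ x y : ℤ, a * x ^ 3 + 3 * b * x ^ 2 * y + 3 * c * x * y ^ 2 + d * y ^ 3 = 0 →
        x = 0 ∧ y = 0) →
    ∃ a' b' c' d' : ℤ, hessDisc a' b' c' d' = hessDisc a b c d ∧ 0 < a' ∧
      0 ≤ b' * c' - a' * d' ∧ b' * c' - a' * d' ≤ b' ^ 2 - a' * c' ∧
      b' ^ 2 - a' * c' ≤ c' ^ 2 - b' * d' := by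
  have norm : ∀ a b c d : ℤ, hessDisc a b c d < 0 →
      (∀ x y : ℤ, a * x ^ 3 + 3 * b * x ^ 2 * y + 3 * c * x * y ^ 2 + d * y ^ 3 = 0 →
        x = 0 ∧ y = 0) → |b * c - a * d| ≤ b ^ 2 - a * c → b ^ 2 - a * c ≤ c ^ 2 - b * d →
      ∃ a' b' c' d' : ℤ, hessDisc a' b' c' d' = hessDisc a b c d ∧ 0 < a' ∧
      0 ≤ b' * c' - a' * d' ∧ b' * c' - a' * d' ≤ b' ^ 2 - a' * c' ∧
      b' ^ 2 - a' * c' ≤ c' ^ 2 - b' * d' := by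
    intro a b c d _ hnv h1 h2
    have ha : a ≠ 0 := by
      rintro rfl
      have := (hnv 1 0 (by ring)).1
      omega
    have h1' := abs_le.1 h1
    rcases le_total 0 (b * c - a * d) with hB | hB <;> rcases lt_or_gt_of_ne ha with ha | ha
    · exact ⟨-a, -b, -c, -d, by unfold hessDisc; ring, by linarith, by linarith, by linarith,
        by linarith⟩
    · exact ⟨a, b, c, d, rfl, ha, by linarith, by linarith, by linarith⟩
    · exact ⟨-a, b, -c, d, by unfold hessDisc; ring, by linarith, by linarith, by linarith,
        by linarith⟩
    · exact ⟨a, -b, c, -d, by unfold hessDisc; ring, by linarith, by linarith, by linarith,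
        by linarith⟩
  have pos : ∀ a b c d : ℤ, hessDisc a b c d < 0 → 0 < b ^ 2 - a * c ∧ 0 < c ^ 2 - b * d := by
    intro a b c d h
    have i1 : 4 * (b ^ 2 - a * c) ^ 3 = (a ^ 2 * d - 3 * a * b * c + 2 * b ^ 3) ^ 2
      - hessDisc a b c d * a ^ 2 := by unfold hessDisc; ring
    have i2 : 4 * (c ^ 2 - b * d) ^ 3 = (a * d ^ 2 - 3 * b * c * d + 2 * c ^ 3) ^ 2
      - hessDisc a b c d * d ^ 2 := by unfold hessDisc; ring
    have j1 : 0 ≤ (b ^ 2 - a * c) ^ 3 := by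
      nlinarith [sq_nonneg a, sq_nonneg (a ^ 2 * d - 3 * a * b * c + 2 * b ^ 3)]
    have j2 : 0 ≤ (c ^ 2 - b * d) ^ 3 := by
      nlinarith [sq_nonneg d, sq_nonneg (a * d ^ 2 - 3 * b * c * d + 2 * c ^ 3)]
    have k1 : 0 ≤ b ^ 2 - a * c := by
      by_contra hh; push Not at hh
      exact absurd j1 (not_le.2 (Odd.pow_neg (by decide) hh))
    have k2 : 0 ≤ c ^ 2 - b * d := by
      by_contra hh; push Not at hh
      exact absurd j2 (not_le.2 (Odd.pow_neg (by decide) hh))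
    unfold hessDisc at h
    constructor
    · rcases k1.eq_or_lt with h0 | h0
      · rw [← h0] at h; nlinarith [sq_nonneg (b * c - a * d)]
      · exact h0
    · rcases k2.eq_or_lt with h0 | h0
      · rw [← h0] at h; nlinarith [sq_nonneg (b * c - a * d)]
      · exact h0
  induction s with
  | zero =>
    intro a b c d h hs _
    obtain ⟨h1, h2⟩ := pos a b c d h
    omega
  | succ s ih =>
    have step : ∀ a b c d : ℤ, hessDisc a b c d < 0 →
        (b ^ 2 - a * c + (c ^ 2 - b * d)).toNat ≤ s + 1 →
        (∀ x y : ℤ, a * x ^ 3 + 3 * b * x ^ 2 * y + 3 * c * x * y ^ 2 + d * y ^ 3 = 0 →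
          x = 0 ∧ y = 0) → b ^ 2 - a * c < |b * c - a * d| →
        ∃ a' b' c' d' : ℤ, hessDisc a' b' c' d' = hessDisc a b c d ∧ 0 < a' ∧
          0 ≤ b' * c' - a' * d' ∧ b' * c' - a' * d' ≤ b' ^ 2 - a' * c' ∧
          b' ^ 2 - a' * c' ≤ c' ^ 2 - b' * d' := by
      intro a b c d h hs hnv hA
      obtain ⟨σ, hσ, hlt⟩ : ∃ σ : ℤ, σ ^ 2 = 1 ∧
          b ^ 2 - a * c + σ * (b * c - a * d) < 0 := by
        rcases lt_abs.1 hA with hA | hA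
        · exact ⟨-1, by norm_num, by linarith⟩
        · exact ⟨1, by norm_num, by linarith⟩
      have hdisc : hessDisc a (b + σ * a) (c + 2 * σ * b + σ ^ 2 * a)
          (d + 3 * σ * c + 3 * σ ^ 2 * b + σ ^ 3 * a) = hessDisc a b c d := by
        unfold hessDisc; ring
      have hAC : (b + σ * a) ^ 2 - a * (c + 2 * σ * b + σ ^ 2 * a) +
          ((c + 2 * σ * b + σ ^ 2 * a) ^ 2
            - (b + σ * a) * (d + 3 * σ * c + 3 * σ ^ 2 * b + σ ^ 3 * a)) =
          (b ^ 2 - a * c) + (c ^ 2 - b * d) + ((b ^ 2 - a * c) + σ * (b * c - a * d)) := by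
        linear_combination (b ^ 2 - a * c) * hσ
      obtain ⟨a', b', c', d', e, r⟩ := ih a (b + σ * a) (c + 2 * σ * b + σ ^ 2 * a)
        (d + 3 * σ * c + 3 * σ ^ 2 * b + σ ^ 3 * a) (by rw [hdisc]; exact h)
        (by rw [hAC]; omega) (by
          intro x y hxy
          have := hnv (x + σ * y) y (by rw [← hxy]; ring)
          obtain ⟨hx, rfl⟩ := this
          simpa using hx)
      exact ⟨a', b', c', d', by rw [e, hdisc], r⟩
    intro a b c d h hs hnv
    have hsw : hessDisc d c b a = hessDisc a b c d := by unfold hessDisc; ring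
    have hnv' : ∀ x y : ℤ, d * x ^ 3 + 3 * c * x ^ 2 * y + 3 * b * x * y ^ 2 + a * y ^ 3 = 0 →
        x = 0 ∧ y = 0 := fun x y hxy => (hnv y x (by linarith)).symm
    have hB : |c * b - d * a| = |b * c - a * d| := by congr 1; ring
    rcases lt_or_ge (b ^ 2 - a * c) |b * c - a * d| with hA | hA
    · exact step a b c d h hs hnv hA
    rcases lt_or_ge (c ^ 2 - d * b) |c * b - d * a| with hC | hC
    · rw [← hsw] at h ⊢
      exact step d c b a h (by rw [← mul_comm a c, mul_comm d b] at *; omega) hnv' hC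
    rcases le_total (b ^ 2 - a * c) (c ^ 2 - b * d) with hAC | hAC
    · exact norm a b c d h hnv hA hAC
    · rw [← hsw] at h ⊢
      exact norm d c b a h hnv' hC (by linarith)

open IntermediateField NumberField in
/-- If `3` divides the class number of `ℚ(√-N)`, there is a reduced binary cubic form of
discriminant `-absDisc N` with nonzero leading coefficient. -/
theorem exists_reduced_form_of_three_dvd {c : ℂ} {D N : ℤ} (hN0 : 0 < N) (hN : Squarefree N)
    (hDN : D = N ∨ D = 4 * N) (hc : c ^ 2 = -(D : ℂ)) [NumberField ℚ⟮c⟯]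
    (h3 : 3 ∣ classNumber ℚ⟮c⟯) :
    ∃ a b c d : ℤ, hessDisc a b c d = - absDisc N ∧ 0 < a ∧ 0 ≤ b * c - a * d ∧
      b * c - a * d ≤ b ^ 2 - a * c ∧ b ^ 2 - a * c ≤ c ^ 2 - b * d := by
  obtain ⟨a₀, a₁, a₂, a₃, hE, hnv⟩ := exists_cubic_form_of_sqrt hN0 hN hDN hc h3
  have hpos : 0 < absDisc N := by unfold absDisc; split_ifs <;> omega
  rw [← hE]
  exact exists_reduced_of_cubic_form _ a₀ a₁ a₂ a₃ (by omega) le_rfl hnv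

end

section

open MeasureTheory

open Filter Topology in
theorem card_mul_le_of_modEq_of_mem_compact {K : Set (ℝ × ℝ × ℝ × ℝ)} (hK : IsCompact K)
    {M : ℕ} (hM : 0 < M) {ε : ℝ} (hε : 0 < ε) :
    ∃ T₀ : ℝ, 0 < T₀ ∧ ∀ T : ℝ, T₀ ≤ T → ∀ S : Finset (ℤ × ℤ × ℤ × ℤ),
      (∀ v ∈ S, ∀ w ∈ S, (M : ℤ) ∣ v.1 - w.1 ∧ (M : ℤ) ∣ v.2.1 - w.2.1 ∧
        (M : ℤ) ∣ v.2.2.1 - w.2.2.1 ∧ (M : ℤ) ∣ v.2.2.2 - w.2.2.2) →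
      (∀ v ∈ S, ((v.1 / T, v.2.1 / T, v.2.2.1 / T, v.2.2.2 / T) : ℝ × ℝ × ℝ × ℝ) ∈ K) →
      (S.card : ℝ) * M ^ 4 ≤ ((volume K).toReal + ε) * T ^ 4 := by
  have hfin : volume K ≠ ⊤ := hK.measure_lt_top.ne
  have hlim := tendsto_measure_cthickening_of_isCompact (μ := volume) hK
  have hlt : volume K < volume K + ENNReal.ofReal ε :=
    ENNReal.lt_add_right hfin (by simpa using hε)
  have hev := hlim.eventually_lt_const hlt
  rw [Metric.eventually_nhds_iff] at hev
  obtain ⟨r, hr, hr'⟩ := hev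
  refine ⟨2 * M / r, by positivity, fun T hT S hS hSK => ?_⟩
  have hM' : (0 : ℝ) < M := by exact_mod_cast hM
  have hT0 : 0 < T := lt_of_lt_of_le (by positivity) hT
  have hMT : M / T < r := by
    rw [div_lt_iff₀ hT0]
    rw [div_le_iff₀ hr] at hT
    nlinarith
  have hvol := hr' (y := M / T) (by
    rw [Real.dist_eq, sub_zero, abs_of_pos (by positivity)]; exact hMT)
  let J : ℤ → Set ℝ := fun n => Set.Ico (n / T) (n / T + M / T)
  have hJ : ∀ n m : ℤ, (M : ℤ) ∣ n - m → ∀ t, t ∈ J n → t ∈ J m → n = m := by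
    rintro n m ⟨k, hk⟩ t ⟨h1, h2⟩ ⟨h3, h4⟩
    have e1 : (n : ℝ) < m + M := by
      have : n / T < m / T + M / T := lt_of_le_of_lt h1 h4
      rw [← add_div, div_lt_div_iff_of_pos_right hT0] at this
      exact this
    have e2 : (m : ℝ) < n + M := by
      have : m / T < n / T + M / T := lt_of_le_of_lt h3 h2
      rw [← add_div, div_lt_div_iff_of_pos_right hT0] at this
      exact this
    have e1' : n < m + M := by exact_mod_cast e1
    have e2' : m < n + M := by exact_mod_cast e2
    have hMz : (0 : ℤ) < M := by exact_mod_cast hM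
    have k0 : k = 0 := by
      have : k < 1 := by nlinarith
      have : -1 < k := by nlinarith
      omega
    rw [k0] at hk
    omega
  let Q : ℤ × ℤ × ℤ × ℤ → Set (ℝ × ℝ × ℝ × ℝ) :=
    fun v => J v.1 ×ˢ J v.2.1 ×ˢ J v.2.2.1 ×ˢ J v.2.2.2
  have hQm : ∀ v, MeasurableSet (Q v) := fun v =>
    measurableSet_Ico.prod (measurableSet_Ico.prod (measurableSet_Ico.prod measurableSet_Ico))
  have hQv : ∀ v, volume (Q v) = ENNReal.ofReal ((M / T) ^ 4) := by
    intro v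
    simp only [Q, J, Measure.volume_eq_prod, Measure.prod_prod, Real.volume_Ico, add_sub_cancel_left]
    rw [← ENNReal.ofReal_mul (by positivity), ← ENNReal.ofReal_mul (by positivity),
      ← ENNReal.ofReal_mul (by positivity)]
    congr 1; ring
  have hdisj : Set.PairwiseDisjoint (S : Set (ℤ × ℤ × ℤ × ℤ)) Q := by
    intro v hv w hw hne
    rw [Function.onFun, Set.disjoint_left]
    rintro ⟨t1, t2, t3, t4⟩ ⟨a1, a2, a3, a4⟩ ⟨b1, b2, b3, b4⟩
    obtain ⟨d1, d2, d3, d4⟩ := hS v hv w hw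
    exact hne (Prod.ext (hJ _ _ d1 _ a1 b1) (Prod.ext (hJ _ _ d2 _ a2 b2)
      (Prod.ext (hJ _ _ d3 _ a3 b3) (hJ _ _ d4 _ a4 b4))))
  have hsub : (⋃ v ∈ S, Q v) ⊆ Metric.cthickening (M / T) K := by
    intro t ht
    simp only [Set.mem_iUnion] at ht
    obtain ⟨v, hv, ⟨a1, a2, a3, a4⟩⟩ := ht
    refine Metric.mem_cthickening_of_dist_le _ _ _ _ (hSK v hv) ?_
    have key : ∀ (n : ℤ) (s : ℝ), s ∈ J n → dist s (n / T) ≤ M / T := by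
      rintro n s ⟨h1, h2⟩
      rw [Real.dist_eq, abs_le]
      constructor <;> [(have : 0 < M / T := by positivity); skip] <;> linarith
    simp only [Prod.dist_eq, max_le_iff]
    exact ⟨key _ _ a1, key _ _ a2, key _ _ a3, key _ _ a4⟩
  have hmain : (S.card : ENNReal) * ENNReal.ofReal ((M / T) ^ 4) ≤ volume K + ENNReal.ofReal ε := by
    calc (S.card : ENNReal) * ENNReal.ofReal ((M / T) ^ 4) = ∑ v ∈ S, volume (Q v) := by
          simp [hQv]
      _ = volume (⋃ v ∈ S, Q v) := (measure_biUnion_finset hdisj fun v _ => hQm v).symm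
      _ ≤ volume (Metric.cthickening (M / T) K) := measure_mono hsub
      _ ≤ _ := hvol.le
  have := ENNReal.toReal_mono (by finiteness) hmain
  rw [ENNReal.toReal_mul, ENNReal.toReal_natCast, ENNReal.toReal_ofReal (by positivity),
    ENNReal.toReal_add hfin (by finiteness), ENNReal.toReal_ofReal hε.le, div_pow] at this
  rw [← mul_div_assoc, div_le_iff₀ (by positivity)] at this
  exact this

theorem card_filter_forall_intCast_mem {κ : Type*} [Fintype κ] [DecidableEq κ]
    (J : Finset ℕ) (q : ℕ → ℕ)
    [∀ p, NeZero (q p)] (hq : (J : Set ℕ).Pairwise (Function.onFun Nat.Coprime q))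
    (L : ∀ p, Finset (κ → ZMod (q p))) :
    ∃ G : Finset (κ → ZMod (∏ p ∈ J, q p)),
      G.card = ∏ p ∈ J, (L p).card ∧
      ∀ v : κ → ℤ, (fun k => (v k : ZMod (∏ p ∈ J, q p))) ∈ G ↔
        ∀ p ∈ J, (fun k => (v k : ZMod (q p))) ∈ L p := by
  classical
  have hM : ∏ p : J, q p = ∏ p ∈ J, q p := Finset.prod_coe_sort J q
  rw [← hM]
  have hcop : Pairwise (Function.onFun Nat.Coprime fun p : J => q p) := fun i j hij =>
    hq i.2 j.2 (fun h => hij (Subtype.ext h))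
  let e : (κ → ZMod (∏ p : J, q p)) ≃ ∀ p : J, κ → ZMod (q p) :=
    (Equiv.piCongrRight fun _ => (ZMod.prodEquivPi (fun p : J => q p) hcop).toEquiv).trans
      (Equiv.piComm _)
  have he : ∀ (v : κ → ℤ) (p : J), e (fun k => (v k : ZMod (∏ p : J, q p))) p =
      fun k => (v k : ZMod (q p)) := by
    intro v p
    ext k
    change ZMod.prodEquivPi (fun p : J => q p) hcop (v k) p = _
    rw [map_intCast, Pi.intCast_apply]
  refine ⟨(Fintype.piFinset fun p : J => L p).map e.symm.toEmbedding, ?_, fun v => ?_⟩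
  · rw [Finset.card_map, Fintype.card_piFinset]
    exact Finset.prod_coe_sort J fun p => (L p).card
  · rw [Finset.mem_map_equiv, Equiv.symm_symm, Fintype.mem_piFinset]
    simp only [he, Subtype.forall]

theorem card_le_prod_of_forall_intCast_mem {K : Set (ℝ × ℝ × ℝ × ℝ)} (hK : IsCompact K)
    (J : Finset ℕ) (q : ℕ → ℕ) [∀ p, NeZero (q p)]
    (hq : (J : Set ℕ).Pairwise (Function.onFun Nat.Coprime q))
    (L : ∀ p, Finset (Fin 4 → ZMod (q p))) {ε : ℝ} (hε : 0 < ε) :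
    ∃ T₀ : ℝ, 0 < T₀ ∧ ∀ T : ℝ, T₀ ≤ T → ∀ S : Finset (ℤ × ℤ × ℤ × ℤ),
      (∀ v ∈ S, ((v.1 / T, v.2.1 / T, v.2.2.1 / T, v.2.2.2 / T) : ℝ × ℝ × ℝ × ℝ) ∈ K) →
      (∀ v ∈ S, ∀ p ∈ J,
        (fun k => ((![v.1, v.2.1, v.2.2.1, v.2.2.2] k : ℤ) : ZMod (q p))) ∈ L p) →
      (S.card : ℝ) ≤ (∏ p ∈ J, ((L p).card / q p ^ 4 : ℝ)) * ((volume K).toReal + ε) * T ^ 4 := by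
  classical
  obtain ⟨M, hMdef, G, hG, hmem⟩ : ∃ M, M = ∏ p ∈ J, q p ∧ ∃ G : Finset (Fin 4 → ZMod M),
      G.card = ∏ p ∈ J, (L p).card ∧ ∀ v : Fin 4 → ℤ, (fun k => (v k : ZMod M)) ∈ G ↔
        ∀ p ∈ J, (fun k => (v k : ZMod (q p))) ∈ L p :=
    ⟨_, rfl, card_filter_forall_intCast_mem J q hq L⟩
  have hM : 0 < M := hMdef ▸ Finset.prod_pos fun p _ => Nat.pos_of_ne_zero (NeZero.ne _)
  obtain ⟨T₀, hT₀, H⟩ := card_mul_le_of_modEq_of_mem_compact hK hM hε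
  refine ⟨T₀, hT₀, fun T hT S hSK hSL => ?_⟩
  let r : ℤ × ℤ × ℤ × ℤ → Fin 4 → ZMod M := fun v k =>
    ((![v.1, v.2.1, v.2.2.1, v.2.2.2] k : ℤ) : ZMod M)
  have hr : ∀ v ∈ S, r v ∈ G := fun v hv => (hmem _).2 (hSL v hv)
  have hfib : ∀ w ∈ G, ((S.filter fun v => r v = w).card : ℝ) * M ^ 4 ≤
      ((volume K).toReal + ε) * T ^ 4 := by
    intro w _
    refine H T hT _ ?_ fun v hv => hSK v (Finset.mem_filter.1 hv).1
    intro v hv v' hv'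
    have h : r v = r v' := (Finset.mem_filter.1 hv).2.trans (Finset.mem_filter.1 hv').2.symm
    have hk := fun k => congrFun h k
    simp only [r, ← sub_eq_zero (b := ((_ : ℤ) : ZMod M)), ← Int.cast_sub,
      ZMod.intCast_zmod_eq_zero_iff_dvd] at hk
    have h0 := hk 0
    have h1 := hk 1
    have h2 := hk 2
    have h3 := hk 3
    simp at h0 h1 h2 h3
    exact ⟨h0, h1, h2, h3⟩
  have hcard : (S.card : ℝ) = ∑ w ∈ G, ((S.filter fun v => r v = w).card : ℝ) := by
    rw [Finset.card_eq_sum_card_fiberwise hr]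
    push_cast
    rfl
  have hsum : (S.card : ℝ) * M ^ 4 ≤ G.card * (((volume K).toReal + ε) * T ^ 4) := by
    rw [hcard, Finset.sum_mul]
    simpa using Finset.sum_le_card_nsmul G _ _ hfib
  have hM4 : (0 : ℝ) < (M : ℝ) ^ 4 := by positivity
  rw [Finset.prod_div_distrib, Finset.prod_pow, ← Nat.cast_prod, ← Nat.cast_prod, ← hG, ← hMdef,
    mul_assoc, div_mul_eq_mul_div, le_div_iff₀ hM4]
  exact hsum
open Filter Topology in
theorem tendsto_prod_one_sub_inv_sq :
    Tendsto (fun n : ℕ => ∏ p ∈ n.primesBelow, (1 - 1 / (p : ℝ) ^ 2)) atTop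
      (𝓝 (6 / Real.pi ^ 2)) := by
  have h := riemannZeta_eulerProduct (s := 2) (by norm_num)
  rw [riemannZeta_two] at h
  have h' := (Complex.continuous_re.tendsto _).comp (h.inv₀ (by simp [Real.pi_ne_zero]))
  convert h' using 1
  · ext n
    simp only [Function.comp]
    rw [← Finset.prod_inv_distrib]
    rw [← Complex.ofReal_re (∏ p ∈ n.primesBelow, (1 - 1 / (p : ℝ) ^ 2))]
    congr 1
    push_cast
    refine Finset.prod_congr rfl fun p _ => ?_
    rw [inv_inv, Complex.cpow_neg, one_div]
    norm_cast
  · rw [← Complex.ofReal_re (6 / Real.pi ^ 2)]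
    simp
theorem filter_primesBelow_prod {f : ℕ → ℝ} {n : ℕ} (hn : 5 ≤ n) :
    ∏ p ∈ n.primesBelow, f p = f 2 * f 3 * ∏ p ∈ n.primesBelow.filter (5 ≤ ·), f p := by
  rw [← Finset.prod_filter_mul_prod_filter_not n.primesBelow (5 ≤ ·), mul_comm]
  congr 1
  have : n.primesBelow.filter (fun p => ¬ 5 ≤ p) = {2, 3} := by
    ext p
    simp only [Finset.mem_filter, Nat.mem_primesBelow, Finset.mem_insert, Finset.mem_singleton]
    constructor
    · rintro ⟨⟨_, hp⟩, h5⟩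
      have := hp.two_le
      interval_cases p
      · simp
      · simp
      · exact absurd hp (by norm_num)
    · rintro (rfl | rfl)
      · exact ⟨⟨by omega, Nat.prime_two⟩, by norm_num⟩
      · exact ⟨⟨by omega, Nat.prime_three⟩, by norm_num⟩
  rw [this, Finset.prod_pair (by norm_num)]

open Filter Topology in
theorem tendsto_prod_one_sub_inv_sq_five_le :
    Tendsto (fun n : ℕ => ∏ p ∈ n.primesBelow.filter (5 ≤ ·), (1 - 1 / (p : ℝ) ^ 2)) atTop
      (𝓝 (9 / Real.pi ^ 2)) := by
  have h := tendsto_prod_one_sub_inv_sq.const_mul (3 / 2)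
  have e : 3 / 2 * (6 / Real.pi ^ 2) = 9 / Real.pi ^ 2 := by ring
  rw [e] at h
  refine h.congr' ?_
  filter_upwards [eventually_ge_atTop 5] with n hn
  rw [filter_primesBelow_prod hn]
  push_cast
  ring
open Finset in
theorem card_hessDisc_eq_zero_ge {R : Type*} [CommRing R] [Fintype R] [DecidableEq R] (n : ℕ)
    (hn : 0 < n)
    (hR : Fintype.card R = n ^ 2) (hU : Nat.card {x : R // ¬ IsUnit x} = n)
    (h0 : ∀ x y : R, ¬ IsUnit x → ¬ IsUnit y → x * y = 0) (h2 : IsUnit (2 : R)) :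
    (2 * n ^ 6 - n ^ 4 : ℤ) ≤
      (univ.filter fun v : R × R × R × R => hessDisc v.1 v.2.1 v.2.2.1 v.2.2.2 = 0).card := by
  classical
  have h00 : ¬ IsUnit (0 : R) := by
    intro h
    have := (isUnit_zero_iff.1 h)
    have hs : Subsingleton R := subsingleton_of_zero_eq_one this
    have : IsEmpty {x : R // ¬ IsUnit x} := ⟨fun x => x.2 ((Subsingleton.elim (0 : R) x.1) ▸ h)⟩
    rw [Nat.card_of_isEmpty] at hU
    omega
  set N : Finset R := univ.filter fun x => ¬ IsUnit x with hN
  set U : Finset R := univ.filter fun x => IsUnit x with hUdef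
  have cN : N.card = n := by rw [← hU, Nat.card_eq_fintype_card, Fintype.card_subtype]
  have cU : (U.card : ℤ) = n ^ 2 - n := by
    have : U.card + N.card = n ^ 2 := by
      rw [← hR, ← card_univ]; exact card_filter_add_card_filter_not _
    rw [cN] at this
    have h' : (U.card : ℤ) + n = n ^ 2 := by exact_mod_cast this
    linarith
  let F : R → R → Finset (R × R) := fun a b => univ.filter fun x => hessDisc a b x.1 x.2 = 0
  have htot : ((univ.filter fun v : R × R × R × R =>
      hessDisc v.1 v.2.1 v.2.2.1 v.2.2.2 = 0).card : ℤ) = ∑ a, ∑ b, ((F a b).card : ℤ) := by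
    simp only [F, card_filter, Fintype.sum_prod_type]
    push_cast
    rfl
  have hsub : ∀ u x : R, IsUnit u → ¬ IsUnit x → IsUnit (u + x) := by
    intro u x hu hx
    refine isUnit_of_mul_isUnit_left (y := u - x) ?_
    have : (u + x) * (u - x) = u ^ 2 := by linear_combination -h0 x x hx hx
    rw [this]; exact hu.pow 2
  have c1 : ∀ a b, IsUnit a → (2 * n ^ 2 - n : ℤ) ≤ (F a b).card := by
    rintro a b ⟨a, rfl⟩
    let t : R := b * ↑a⁻¹
    have ht : t * a = b := by simp [t]
    let sh : R × R → R × R := fun x =>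
      (x.1 + 2 * b * t - a * t ^ 2, x.2 + 3 * x.1 * t + a * t ^ 3)
    have hsh : ∀ x, hessDisc (a : R) b (sh x).1 (sh x).2 = a ^ 2 * x.2 ^ 2 + 4 * a * x.1 ^ 3 := by
      intro x
      simp only [hessDisc, sh, ← ht]
      ring
    have hinj : Function.Injective sh := by
      rintro ⟨x, y⟩ ⟨x', y'⟩ h
      simp only [sh, Prod.mk.injEq] at h
      have e1 : x = x' := by linear_combination h.1
      refine Prod.ext e1 ?_
      linear_combination h.2 - 3 * t * e1
    let A1 : Finset (R × R) := U.image fun s => (-(a : R) * s ^ 2, 2 * (a : R) * s ^ 3)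
    let A2 : Finset (R × R) := N ×ˢ N
    have hA1 : A1.card = U.card := by
      refine card_image_of_injOn ?_
      intro s hs s' hs' h
      have hs := (mem_filter.1 hs).2
      simp only [Prod.mk.injEq] at h
      have k1 : s ^ 2 = s' ^ 2 := by
        have := a.isUnit.neg.mul_left_cancel h.1
        exact this
      have k2 : s ^ 3 = s' ^ 3 := (h2.mul a.isUnit).mul_left_cancel h.2
      refine (hs.pow 2).mul_left_cancel ?_
      linear_combination k2 - s' * k1
    have hdis : Disjoint A1 A2 := by
      rw [Finset.disjoint_left]
      intro x hx hx'
      obtain ⟨s, hs, rfl⟩ := mem_image.1 hx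
      have := (mem_filter.1 (mem_product.1 hx').1).2
      exact this ((a.isUnit.neg).mul ((mem_filter.1 hs).2.pow 2))
    have hle : ((A1 ∪ A2).image sh).card ≤ (F a b).card := by
      refine card_le_card ?_
      intro x hx
      obtain ⟨y, hy, rfl⟩ := mem_image.1 hx
      simp only [F, mem_filter, mem_univ, true_and, hsh]
      rcases mem_union.1 hy with hy | hy
      · obtain ⟨s, hs, rfl⟩ := mem_image.1 hy
        simp only; ring
      · have h1 := (mem_filter.1 (mem_product.1 hy).1).2
        have h2 := (mem_filter.1 (mem_product.1 hy).2).2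
        linear_combination a ^ 2 * h0 _ _ h2 h2 + 4 * a * y.1 * h0 _ _ h1 h1
    rw [card_image_of_injective _ hinj, card_union_of_disjoint hdis, hA1, card_product, cN] at hle
    have : ((U.card : ℤ) + n * n) ≤ (F a b).card := by exact_mod_cast hle
    rw [cU] at this
    linarith
  have c2 : ∀ a b, ¬ IsUnit a → IsUnit b → (n ^ 2 : ℤ) ≤ (F a b).card := by
    intro a b ha hb
    have hu : ∀ c, IsUnit (4 * b ^ 3 + a * (-6 * b * c)) := by
      intro c
      refine hsub _ _ ?_ fun h => ha (isUnit_of_mul_isUnit_left h)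
      have : (4 : R) = 2 * 2 := by norm_num
      rw [this]
      exact (h2.mul h2).mul (hb.pow 3)
    have hle : (univ.image fun c : R =>
        (c, (3 * b ^ 2 * c ^ 2 - 4 * a * c ^ 3) * ↑((hu c).unit⁻¹))).card ≤ (F a b).card := by
      refine card_le_card ?_
      intro x hx
      obtain ⟨c, -, rfl⟩ := mem_image.1 hx
      simp only [F, mem_filter, mem_univ, true_and]
      have hi : (4 * b ^ 3 + a * (-6 * b * c)) * ↑((hu c).unit⁻¹) = 1 := (hu c).mul_val_inv
      set i : R := ↑((hu c).unit⁻¹)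
      have haa := h0 a a ha ha
      unfold hessDisc
      linear_combination (3 * b ^ 2 * c ^ 2 - 4 * a * c ^ 3) * hi +
        ((3 * b ^ 2 * c ^ 2 - 4 * a * c ^ 3) * i) ^ 2 * haa
    rw [card_image_of_injective _ fun x y h => (Prod.mk.inj h).1, card_univ, hR] at hle
    exact_mod_cast hle
  have c3 : ∀ a b, ¬ IsUnit a → ¬ IsUnit b → (n ^ 3 : ℤ) ≤ (F a b).card := by
    intro a b ha hb
    have hle : (N ×ˢ (univ : Finset R)).card ≤ (F a b).card := by
      refine card_le_card ?_
      rintro ⟨c, d⟩ hx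
      have hc := (mem_filter.1 (mem_product.1 hx).1).2
      simp only [F, mem_filter, mem_univ, true_and]
      unfold hessDisc
      linear_combination (c ^ 2 - 4 * (c ^ 2 - b * d)) * h0 b b hb hb - 2 * c * d * h0 a b ha hb
        + d ^ 2 * h0 a a ha ha + 4 * (c ^ 2 - b * d) * h0 a c ha hc
    rw [card_product, cN, card_univ, hR] at hle
    have : ((n * n ^ 2 : ℕ) : ℤ) ≤ (F a b).card := by exact_mod_cast hle
    push_cast at this
    linarith
  have c4 : ∀ b, ¬ IsUnit b → (n ^ 4 : ℤ) ≤ (F 0 b).card := by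
    intro b hb
    have hle : (univ : Finset (R × R)).card ≤ (F 0 b).card := by
      refine card_le_card ?_
      rintro ⟨c, d⟩ -
      simp only [F, mem_filter, mem_univ, true_and]
      unfold hessDisc
      linear_combination (c ^ 2 - 4 * (c ^ 2 - b * d)) * h0 b b hb hb
    rw [card_univ, Fintype.card_prod, hR] at hle
    have : ((n ^ 2 * n ^ 2 : ℕ) : ℤ) ≤ (F 0 b).card := by exact_mod_cast hle
    push_cast at this
    linarith
  rw [htot]
  have hb : ∀ a, (if IsUnit a then (n ^ 2 * (2 * n ^ 2 - n) : ℤ) else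
      (n ^ 2 - n) * n ^ 2 + n * n ^ 3 + if a = 0 then n * (n ^ 4 - n ^ 3 : ℤ) else 0) ≤
      ∑ b, ((F a b).card : ℤ) := by
    intro a
    split_ifs with h1 h2
    · have := card_nsmul_le_sum (univ : Finset R) (fun b => ((F a b).card : ℤ)) _
        fun b _ => c1 a b h1
      rw [card_univ, hR, nsmul_eq_mul] at this
      exact_mod_cast this
    all_goals
      rw [← sum_filter_add_sum_filter_not univ (fun b : R => IsUnit b)]
      have k1 := card_nsmul_le_sum U (fun b => ((F a b).card : ℤ)) _
        fun b hb => c2 a b h1 (mem_filter.1 hb).2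
      rw [nsmul_eq_mul, cU] at k1
    · have k2 := card_nsmul_le_sum N (fun b => ((F a b).card : ℤ)) _
        fun b hb => h2 ▸ c4 b (mem_filter.1 hb).2
      rw [nsmul_eq_mul, cN] at k2
      linarith
    · have k2 := card_nsmul_le_sum N (fun b => ((F a b).card : ℤ)) _
        fun b hb => c3 a b h1 (mem_filter.1 hb).2
      rw [nsmul_eq_mul, cN] at k2
      linarith
  refine le_trans ?_ (sum_le_sum fun a _ => hb a)
  rw [sum_ite, sum_add_distrib, ← sum_filter, filter_filter]
  have hz : (univ.filter fun a : R => ¬ IsUnit a ∧ a = 0) = {0} := by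
    ext a
    simp only [mem_filter, mem_univ, true_and, mem_singleton]
    exact ⟨fun h => h.2, fun h => ⟨h ▸ h00, h⟩⟩
  rw [hz]
  simp only [sum_const, card_singleton, nsmul_eq_mul]
  change _ ≤ (U.card : ℤ) * _ + ((N.card : ℤ) * _ + _)
  rw [cU, cN]
  push_cast
  apply le_of_eq
  ring
theorem card_filter_fin_four {R : Type*} [Fintype R] [DecidableEq R] (P : R → R → R → R → Prop)
    [∀ a b c d, Decidable (P a b c d)] :
    (Finset.univ.filter fun w : Fin 4 → R => P (w 0) (w 1) (w 2) (w 3)).card =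
      (Finset.univ.filter fun v : R × R × R × R => P v.1 v.2.1 v.2.2.1 v.2.2.2).card := by
  refine Finset.card_bij' (fun w _ => (w 0, w 1, w 2, w 3))
    (fun v _ => ![v.1, v.2.1, v.2.2.1, v.2.2.2]) ?_ ?_ ?_ ?_
  · intro w hw; simpa using hw
  · intro v hv; simpa using hv
  · intro w _
    ext i
    fin_cases i <;> rfl
  · intro v _; rfl

theorem card_hessDisc_ne_zero_le {p : ℕ} (hp : p.Prime) (hp2 : p ≠ 2) [NeZero (p ^ 2)] :
    ((Finset.univ.filter fun v : ZMod (p ^ 2) × ZMod (p ^ 2) × ZMod (p ^ 2) × ZMod (p ^ 2) =>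
      hessDisc v.1 v.2.1 v.2.2.1 v.2.2.2 ≠ 0).card : ℝ) / ((p ^ 2 : ℕ) : ℝ) ^ 4 ≤
      (1 - 1 / (p : ℝ) ^ 2) ^ 2 := by
  have hunit : ∀ x : ZMod (p ^ 2), IsUnit x ↔ ¬ p ∣ x.val := by
    intro x
    conv_lhs => rw [← ZMod.natCast_zmod_val x]
    rw [ZMod.isUnit_iff_coprime, Nat.coprime_pow_right_iff (by norm_num), Nat.coprime_comm,
      hp.coprime_iff_not_dvd]
  have hU : Nat.card {x : ZMod (p ^ 2) // ¬ IsUnit x} = p := by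
    have h1 : Nat.card {x : ZMod (p ^ 2) // IsUnit x} = p * (p - 1) := by
      have e : (ZMod (p ^ 2))ˣ ≃ {x : ZMod (p ^ 2) // IsUnit x} :=
        Equiv.ofBijective (fun u => ⟨u, u.isUnit⟩)
          ⟨fun u v h => Units.ext (Subtype.mk.inj h), fun ⟨x, hx⟩ => ⟨hx.unit, rfl⟩⟩
      rw [← Nat.card_congr e, Nat.card_eq_fintype_card, ZMod.card_units_eq_totient,
        Nat.totient_prime_pow hp (by norm_num)]
      simp
    classical
    have h2 : Nat.card {x : ZMod (p ^ 2) // IsUnit x} + Nat.card {x : ZMod (p ^ 2) // ¬ IsUnit x}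
        = p ^ 2 := by
      rw [← Nat.card_sum, Nat.card_congr (Equiv.sumCompl _), Nat.card_zmod]
    rw [h1] at h2
    obtain ⟨k, rfl⟩ : ∃ k, p = k + 1 := ⟨p - 1, by have := hp.pos; omega⟩
    simp only [Nat.add_sub_cancel] at h2
    nlinarith
  have key := card_hessDisc_eq_zero_ge (R := ZMod (p ^ 2)) p hp.pos (ZMod.card _) hU ?_ ?_
  · have htot := Finset.card_filter_add_card_filter_not (s := Finset.univ)
      (fun v : ZMod (p ^ 2) × ZMod (p ^ 2) × ZMod (p ^ 2) × ZMod (p ^ 2) =>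
        hessDisc v.1 v.2.1 v.2.2.1 v.2.2.2 = 0)
    rw [Finset.card_univ, Fintype.card_prod, Fintype.card_prod, Fintype.card_prod, ZMod.card] at htot
    have htot' : (((Finset.univ.filter fun v : ZMod (p ^ 2) × ZMod (p ^ 2) × ZMod (p ^ 2) ×
        ZMod (p ^ 2) => hessDisc v.1 v.2.1 v.2.2.1 v.2.2.2 = 0).card : ℕ) : ℝ) +
        ((Finset.univ.filter fun v : ZMod (p ^ 2) × ZMod (p ^ 2) × ZMod (p ^ 2) × ZMod (p ^ 2) =>
      hessDisc v.1 v.2.1 v.2.2.1 v.2.2.2 ≠ 0).card : ℝ) = p ^ 2 * (p ^ 2 * (p ^ 2 * p ^ 2)) := by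
      exact_mod_cast htot
    have key' : (2 * p ^ 6 - p ^ 4 : ℝ) ≤ (((Finset.univ.filter fun v : ZMod (p ^ 2) × ZMod (p ^ 2) ×
        ZMod (p ^ 2) × ZMod (p ^ 2) => hessDisc v.1 v.2.1 v.2.2.1 v.2.2.2 = 0).card : ℕ) : ℝ) := by
      exact_mod_cast key
    have hp0 : (0 : ℝ) < p := by exact_mod_cast hp.pos
    rw [div_le_iff₀ (by push_cast; positivity)]
    push_cast
    have e : (1 - 1 / (p : ℝ) ^ 2) ^ 2 * ((p : ℝ) ^ 2) ^ 4 = p ^ 8 - 2 * p ^ 6 + p ^ 4 := by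
      field_simp
      ring
    rw [e]
    linarith
  · intro x y hx hy
    rw [hunit, not_not] at hx hy
    rw [← ZMod.natCast_zmod_val x, ← ZMod.natCast_zmod_val y, ← Nat.cast_mul,
      ZMod.natCast_eq_zero_iff]
    have h := mul_dvd_mul hx hy
    rwa [← pow_two] at h
  · have : ((2 : ℕ) : ZMod (p ^ 2)) = 2 := by norm_num
    rw [← this, ZMod.isUnit_iff_coprime, Nat.coprime_pow_right_iff (by norm_num)]
    exact ((Nat.coprime_primes hp Nat.prime_two).2 hp2).symm

/-- The square of each prime, except that `3` is kept to the first power. -/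
def sieveModulus (p : ℕ) : ℕ := if p = 3 then 3 else if p.Prime then p ^ 2 else 1

instance (p : ℕ) : NeZero (sieveModulus p) := by
  refine ⟨?_⟩
  unfold sieveModulus
  split_ifs with h1 h2
  · norm_num
  · exact pow_ne_zero _ h2.ne_zero
  · norm_num

theorem sieveModulus_coprime (n : ℕ) :
    (n.primesBelow : Set ℕ).Pairwise (Function.onFun Nat.Coprime sieveModulus) := by
  intro p hp r hr hne
  have hp := Nat.prime_of_mem_primesBelow hp
  have hr := Nat.prime_of_mem_primesBelow hr
  have h := (Nat.coprime_primes hp hr).2 hne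
  have key : ∀ p : ℕ, p.Prime → ∃ k, sieveModulus p = p ^ k := by
    intro p hp
    unfold sieveModulus
    split_ifs with h1
    · exact ⟨1, by simp [h1]⟩
    · exact ⟨2, rfl⟩
  obtain ⟨k, hk⟩ := key p hp
  obtain ⟨l, hl⟩ := key r hr
  rw [Function.onFun, hk, hl]
  exact Nat.Coprime.pow _ _ h

/-- The condition at `2`: the pair of invariants `(bc - ad, (b² - ac)(c² - bd))` lies in `E`. -/
def hessCond {R : Type*} [CommRing R] (E : Finset (ℤ × ℤ)) (a b c d : R) : Prop :=
  ∃ e ∈ E, b * c - a * d = (e.1 : R) ∧ (b ^ 2 - a * c) * (c ^ 2 - b * d) = (e.2 : R)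

instance {R : Type*} [CommRing R] [DecidableEq R] (E : Finset (ℤ × ℤ)) (a b c d : R) :
    Decidable (hessCond E a b c d) := by unfold hessCond; infer_instance

theorem card_four_fam_one : (Finset.univ.filter fun v : ZMod 4 × ZMod 4 × ZMod 4 × ZMod 4 =>
    hessCond {(0, 1), (2, 2)} v.1 v.2.1 v.2.2.1 v.2.2.2).card = 24 := by
  decide +kernel

theorem card_four_fam_two : (Finset.univ.filter fun v : ZMod 4 × ZMod 4 × ZMod 4 × ZMod 4 =>
    hessCond ({1, 3} ×ˢ {0, 1, 2, 3}) v.1 v.2.1 v.2.2.1 v.2.2.2).card = 96 := by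
  decide +kernel

theorem card_four_fam_three : (Finset.univ.filter fun v : ZMod 4 × ZMod 4 × ZMod 4 × ZMod 4 =>
    hessCond {(0, 2), (2, 3)} v.1 v.2.1 v.2.2.1 v.2.2.2).card = 24 := by
  decide +kernel

theorem card_hessDisc_zmod_three : (Finset.univ.filter fun v : ZMod 3 × ZMod 3 × ZMod 3 × ZMod 3 =>
    hessDisc v.1 v.2.1 v.2.2.1 v.2.2.2 = -1).card = 24 := by
  decide +kernel
theorem card_sieved_forms_le {K : Set (ℝ × ℝ × ℝ × ℝ)} (hK : IsCompact K) (E : Finset (ℤ × ℤ))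
    {k : ℕ} (hE : (Finset.univ.filter fun v : ZMod 4 × ZMod 4 × ZMod 4 × ZMod 4 =>
      hessCond E v.1 v.2.1 v.2.2.1 v.2.2.2).card = k) {ε : ℝ} (hε : 0 < ε) :
    ∃ T₀ : ℝ, 0 < T₀ ∧ ∀ T : ℝ, T₀ ≤ T → ∀ S : Finset (ℤ × ℤ × ℤ × ℤ),
      (∀ v ∈ S, ((v.1 / T, v.2.1 / T, v.2.2.1 / T, v.2.2.2 / T) : ℝ × ℝ × ℝ × ℝ) ∈ K) →
      (∀ v ∈ S, hessCond E (v.1 : ZMod 4) v.2.1 v.2.2.1 v.2.2.2) →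
      (∀ v ∈ S, hessDisc v.1 v.2.1 v.2.2.1 v.2.2.2 % 3 = 2) →
      (∀ v ∈ S, ∀ p : ℕ, p.Prime → 5 ≤ p → ¬ (p : ℤ) ^ 2 ∣ hessDisc v.1 v.2.1 v.2.2.1 v.2.2.2) →
      (S.card : ℝ) ≤ (3 * k / (32 * Real.pi ^ 4) * (volume K).toReal + ε) * T ^ 4 := by
  have hlim : Filter.Tendsto (fun n : ℕ =>
      (k / 256 * (8 / 27) * (∏ p ∈ n.primesBelow.filter (5 ≤ ·), (1 - 1 / (p : ℝ) ^ 2)) ^ 2) *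
      ((volume K).toReal + 1 / (n + 1))) Filter.atTop
      (nhds ((k / 256 * (8 / 27) * (9 / Real.pi ^ 2) ^ 2) * ((volume K).toReal + 0))) :=
    ((tendsto_prod_one_sub_inv_sq_five_le.pow 2).const_mul _).mul
      (tendsto_const_nhds.add tendsto_one_div_add_atTop_nhds_zero_nat)
  have hval : (k / 256 * (8 / 27) * (9 / Real.pi ^ 2) ^ 2) * ((volume K).toReal + 0) =
      3 * k / (32 * Real.pi ^ 4) * (volume K).toReal := by
    field_simp
    ring
  rw [hval] at hlim
  obtain ⟨n, hn, hn5⟩ := ((hlim.eventually_le_const (lt_add_of_pos_right _ hε)).and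
    (Filter.eventually_ge_atTop 5)).exists
  let L : ∀ p, Finset (Fin 4 → ZMod (sieveModulus p)) := fun p => Finset.univ.filter fun w =>
    (p = 2 → hessCond E (w 0) (w 1) (w 2) (w 3)) ∧
    (p = 3 → hessDisc (w 0) (w 1) (w 2) (w 3) = -1) ∧
    (5 ≤ p → hessDisc (w 0) (w 1) (w 2) (w 3) ≠ 0)
  obtain ⟨T₀, hT₀, H⟩ := card_le_prod_of_forall_intCast_mem hK n.primesBelow sieveModulus
    (sieveModulus_coprime n) L (ε := 1 / (n + 1)) (by positivity)
  refine ⟨T₀, hT₀, fun T hT S hSK h2 h3 h5 => (H T hT S hSK ?_).trans ?_⟩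
  · intro v hv p hp
    have hpp := Nat.prime_of_mem_primesBelow hp
    simp only [L, Finset.mem_filter, Finset.mem_univ, true_and]
    have hc : hessDisc ((![v.1, v.2.1, v.2.2.1, v.2.2.2] 0 : ℤ) : ZMod (sieveModulus p))
        ((![v.1, v.2.1, v.2.2.1, v.2.2.2] 1 : ℤ) : ZMod (sieveModulus p))
        ((![v.1, v.2.1, v.2.2.1, v.2.2.2] 2 : ℤ) : ZMod (sieveModulus p))
        ((![v.1, v.2.1, v.2.2.1, v.2.2.2] 3 : ℤ) : ZMod (sieveModulus p)) =
        ((hessDisc v.1 v.2.1 v.2.2.1 v.2.2.2 : ℤ) : ZMod (sieveModulus p)) := by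
      simp [hessDisc]
    rw [hc]
    refine ⟨?_, ?_, ?_⟩
    · rintro rfl
      exact h2 v hv
    · rintro rfl
      change ((hessDisc v.1 v.2.1 v.2.2.1 v.2.2.2 : ℤ) : ZMod 3) = -1
      have : ((hessDisc v.1 v.2.1 v.2.2.1 v.2.2.2 : ℤ) : ZMod 3) = ((-1 : ℤ) : ZMod 3) := by
        rw [ZMod.intCast_eq_intCast_iff]
        have := h3 v hv
        exact (show _ % _ = _ % _ by omega)
      rw [this]
      norm_num
    · intro hp5
      rw [Ne, ZMod.intCast_zmod_eq_zero_iff_dvd]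
      have : sieveModulus p = p ^ 2 := by
        unfold sieveModulus
        rw [if_neg (by omega), if_pos hpp]
      rw [this]
      push_cast
      exact h5 v hv p hpp hp5
  · refine mul_le_mul_of_nonneg_right (le_trans ?_ hn) ((by decide : Even 4).pow_nonneg T)
    refine mul_le_mul_of_nonneg_right ?_ (by positivity)
    rw [filter_primesBelow_prod (f := fun p => ((L p).card / sieveModulus p ^ 4 : ℝ)) hn5]
    have l2 : ((L 2).card / sieveModulus 2 ^ 4 : ℝ) = k / 256 := by
      have hL : ∀ m : ℕ, ∀ (_ : NeZero m), sieveModulus 2 = m → (L 2).card =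
          (Finset.univ.filter fun v : ZMod m × ZMod m × ZMod m × ZMod m =>
            hessCond E v.1 v.2.1 v.2.2.1 v.2.2.2).card := by
        rintro m hm rfl
        rw [← card_filter_fin_four (R := ZMod (sieveModulus 2)) fun a b c d => hessCond E a b c d]
        congr 1
        ext w
        simp only [L, Finset.mem_filter, Finset.mem_univ, true_and]
        exact ⟨fun h => h.1 trivial, fun h => ⟨fun _ => h, by omega, by omega⟩⟩
      have : (L 2).card = k := by
        rw [← hE]
        exact hL 4 inferInstance (by norm_num [sieveModulus, Nat.prime_two])
      rw [this]
      norm_num [sieveModulus, Nat.prime_two]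
    have l3 : ((L 3).card / sieveModulus 3 ^ 4 : ℝ) = 8 / 27 := by
      have : (L 3).card = 24 := by
        rw [← card_hessDisc_zmod_three]
        have := card_filter_fin_four (R := ZMod 3) fun a b c d => hessDisc a b c d = -1
        rw [← this]
        congr 1
      rw [this]
      norm_num [sieveModulus]
    rw [l2, l3, ← Finset.prod_pow]
    refine mul_le_mul_of_nonneg_left ?_ (by positivity)
    refine Finset.prod_le_prod (fun p _ => by positivity) fun p hp => ?_
    obtain ⟨hp, hp5⟩ := Finset.mem_filter.1 hp
    have hpp := Nat.prime_of_mem_primesBelow hp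
    have hq : sieveModulus p = p ^ 2 := by
      unfold sieveModulus
      rw [if_neg (by omega), if_pos hpp]
    have : NeZero (p ^ 2) := ⟨pow_ne_zero _ hpp.ne_zero⟩
    refine le_trans (le_of_eq ?_) (card_hessDisc_ne_zero_le hpp (by omega))
    have hL : ∀ m : ℕ, ∀ (_ : NeZero m), sieveModulus p = m → (L p).card =
        (Finset.univ.filter fun v : ZMod m × ZMod m × ZMod m × ZMod m =>
          hessDisc v.1 v.2.1 v.2.2.1 v.2.2.2 ≠ 0).card := by
      rintro m hm rfl
      rw [← card_filter_fin_four (R := ZMod (sieveModulus p)) fun a b c d => hessDisc a b c d ≠ 0]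
      congr 1
      ext w
      simp only [L, Finset.mem_filter, Finset.mem_univ, true_and]
      exact ⟨fun h => h.2.2 hp5, fun h => ⟨by omega, by omega, fun _ => h⟩⟩
    rw [hL _ this hq, hq]
/-- The reduced binary cubic forms of discriminant bounded by `X`. -/
def IsReducedForm (X : ℝ) (v : ℤ × ℤ × ℤ × ℤ) : Prop :=
  0 < v.1 ∧ 0 ≤ v.2.1 * v.2.2.1 - v.1 * v.2.2.2 ∧
    v.2.1 * v.2.2.1 - v.1 * v.2.2.2 ≤ v.2.1 ^ 2 - v.1 * v.2.2.1 ∧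
    v.2.1 ^ 2 - v.1 * v.2.2.1 ≤ v.2.2.1 ^ 2 - v.2.1 * v.2.2.2 ∧
    hessDisc v.1 v.2.1 v.2.2.1 v.2.2.2 < 0 ∧
    -(hessDisc v.1 v.2.1 v.2.2.1 v.2.2.2 : ℝ) ≤ X

theorem coeff_bounds_of_reduced {a b c d T t : ℝ} (hT : 0 < T) (ht : 1 ≤ t)
    (hA : 0 < b ^ 2 - a * c) (hB0 : 0 ≤ b * c - a * d) (hBA : b * c - a * d ≤ b ^ 2 - a * c)
    (hAC : b ^ 2 - a * c ≤ c ^ 2 - b * d) (hX : -hessDisc a b c d ≤ T ^ 4)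
    (h1 : t ^ 4 * (b ^ 2 - a * c) ≤ c ^ 2 - b * d)
    (h2 : c ^ 2 - b * d ≤ 16 * t ^ 4 * (b ^ 2 - a * c)) :
    |a| * t ^ 3 ≤ 2 * T ∧ |b| * t ≤ 2 * T ∧ |c| ≤ 4 * t * T ∧ |d| ≤ 10 * t ^ 3 * T := by
  have key : ∀ x y : ℝ, 0 ≤ y → x ^ 4 ≤ y ^ 4 → |x| ≤ y := fun x y hy h => by
    rwa [← Even.pow_abs (by decide : Even 4),
      pow_le_pow_iff_left₀ (abs_nonneg x) hy (by norm_num)] at h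
  have s0 : -hessDisc a b c d * a ^ 2 + (a^2*d-3*a*b*c+2*b^3)^2 = 4 * (b ^ 2 - a * c) ^ 3 := by
    unfold hessDisc; ring
  have s1 : -hessDisc a b c d * b ^ 2 + (a*b*d-2*a*c^2+b^2*c)^2 =
      4 * (b ^ 2 - a * c) ^ 2 * (c ^ 2 - b * d) := by
    unfold hessDisc; ring
  have s2 : -hessDisc a b c d * c ^ 2 + (a*c*d-2*b^2*d+b*c^2)^2 =
      4 * (b ^ 2 - a * c) * (c ^ 2 - b * d) ^ 2 := by
    unfold hessDisc; ring
  have s3 : -hessDisc a b c d * d ^ 2 + (a*d^2-3*b*c*d+2*c^3)^2 = 4 * (c ^ 2 - b * d) ^ 3 := by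
    unfold hessDisc; ring
  have hδ : -hessDisc a b c d = 4 * (b ^ 2 - a * c) * (c ^ 2 - b * d) - (b * c - a * d) ^ 2 := by
    unfold hessDisc; ring
  generalize -hessDisc a b c d = δ at *
  generalize (a^2*d-3*a*b*c+2*b^3) = g0 at *
  generalize (a*b*d-2*a*c^2+b^2*c) = g1 at *
  generalize (a*c*d-2*b^2*d+b*c^2) = g2 at *
  generalize (a*d^2-3*b*c*d+2*c^3) = g3 at *
  generalize b ^ 2 - a * c = A at *
  generalize b * c - a * d = B at *
  generalize c ^ 2 - b * d = C at *
  have hC : 0 < C := hA.trans_le hAC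
  have hACpos : 0 < A * C := mul_pos hA hC
  have hδ3 : 3 * (A * C) ≤ δ := by
    linear_combination -hδ + mul_le_mul hBA hBA hB0 hA.le + mul_le_mul_of_nonneg_left hAC hA.le
  have hb : 3 * b ^ 2 ≤ 4 * A := by
    have h : 3 * (A * C) * b ^ 2 ≤ δ * b ^ 2 := mul_le_mul_of_nonneg_right hδ3 (sq_nonneg b)
    have : A * C * (3 * b ^ 2) ≤ A * C * (4 * A) := by
      linear_combination h + sq_nonneg g1 + s1
    exact le_of_mul_le_mul_left this hACpos
  have hc : 3 * c ^ 2 ≤ 4 * C := by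
    have h : 3 * (A * C) * c ^ 2 ≤ δ * c ^ 2 := mul_le_mul_of_nonneg_right hδ3 (sq_nonneg c)
    have : A * C * (3 * c ^ 2) ≤ A * C * (4 * C) := by
      linear_combination h + sq_nonneg g2 + s2
    exact le_of_mul_le_mul_left this hACpos
  have ha : 3 * (C * a ^ 2) ≤ 4 * A ^ 2 := by
    have h : 3 * (A * C) * a ^ 2 ≤ δ * a ^ 2 := mul_le_mul_of_nonneg_right hδ3 (sq_nonneg a)
    have : A * (3 * (C * a ^ 2)) ≤ A * (4 * A ^ 2) := by
      linear_combination h + sq_nonneg g0 + s0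
    exact le_of_mul_le_mul_left this hA
  have hd : 3 * (A * d ^ 2) ≤ 4 * C ^ 2 := by
    have h : 3 * (A * C) * d ^ 2 ≤ δ * d ^ 2 := mul_le_mul_of_nonneg_right hδ3 (sq_nonneg d)
    have : C * (3 * (A * d ^ 2)) ≤ C * (4 * C ^ 2) := by
      linear_combination h + sq_nonneg g3 + s3
    exact le_of_mul_le_mul_left this hC
  have hAC3 : 3 * (A * C) ≤ T ^ 4 := hδ3.trans hX
  have hA2 : 3 * (t ^ 4 * A ^ 2) ≤ T ^ 4 := by
    linear_combination 3 * mul_le_mul_of_nonneg_left h1 hA.le + hAC3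
  have hC2 : 3 * C ^ 2 ≤ 16 * t ^ 4 * T ^ 4 := by
    have h : C * C ≤ 16 * t ^ 4 * A * C := mul_le_mul_of_nonneg_right h2 hC.le
    have : 16 * t ^ 4 * (3 * (A * C)) ≤ 16 * t ^ 4 * T ^ 4 :=
      mul_le_mul_of_nonneg_left hAC3 (by positivity)
    linear_combination 3 * h + this
  have ha' : 3 * (t ^ 4 * a ^ 2) ≤ 4 * A := by
    have h : t ^ 4 * A * a ^ 2 ≤ C * a ^ 2 := mul_le_mul_of_nonneg_right h1 (sq_nonneg a)
    have : A * (3 * (t ^ 4 * a ^ 2)) ≤ A * (4 * A) := by linear_combination 3 * h + ha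
    exact le_of_mul_le_mul_left this hA
  have hd' : 3 * d ^ 2 ≤ 64 * t ^ 4 * C := by
    have h : C * d ^ 2 ≤ 16 * t ^ 4 * A * d ^ 2 := mul_le_mul_of_nonneg_right h2 (sq_nonneg d)
    have h16 : 16 * t ^ 4 * (3 * (A * d ^ 2)) ≤ 16 * t ^ 4 * (4 * C ^ 2) :=
      mul_le_mul_of_nonneg_left hd (by positivity)
    have : C * (3 * d ^ 2) ≤ C * (64 * t ^ 4 * C) := by linear_combination 3 * h + h16
    exact le_of_mul_le_mul_left this hC
  have sq : ∀ x y : ℝ, 0 ≤ x → x ≤ y → x ^ 2 ≤ y ^ 2 := fun x y hx h => pow_le_pow_left₀ hx h 2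
  have hT4 : 0 < T ^ 4 := by positivity
  refine ⟨?_, ?_, ?_, ?_⟩
  · have e : |a| * t ^ 3 = |a * t ^ 3| := by rw [abs_mul, abs_of_nonneg (by positivity : 0 ≤ t ^ 3)]
    rw [e]
    refine key _ _ (by positivity) ?_
    have h := sq _ _ (by positivity) ha'
    have : t ^ 4 * (3 * (t ^ 4 * a ^ 2)) ^ 2 ≤ t ^ 4 * (4 * A) ^ 2 :=
      mul_le_mul_of_nonneg_left h (by positivity)
    linear_combination (1 / 9) * this + (16 / 27) * hA2 + (16 - 16 / 27) * hT4.le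
  · have e : |b| * t = |b * t| := by rw [abs_mul, abs_of_nonneg (by positivity : 0 ≤ t)]
    rw [e]
    refine key _ _ (by positivity) ?_
    have h := sq _ _ (by positivity) hb
    have : t ^ 4 * (3 * b ^ 2) ^ 2 ≤ t ^ 4 * (4 * A) ^ 2 :=
      mul_le_mul_of_nonneg_left h (by positivity)
    linear_combination (1 / 9) * this + (16 / 27) * hA2 + (16 - 16 / 27) * hT4.le
  · refine key _ _ (by positivity) ?_
    have h := sq _ _ (by positivity) hc
    have : 0 ≤ t ^ 4 * T ^ 4 := by positivity
    linear_combination (1 / 9) * h + (16 / 27) * hC2 + (256 - 256 / 27) * this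
  · refine key _ _ (by positivity) ?_
    have h := sq _ _ (by positivity) hd'
    have h3 : (64 * t ^ 4) ^ 2 * (3 * C ^ 2) ≤ (64 * t ^ 4) ^ 2 * (16 * t ^ 4 * T ^ 4) :=
      mul_le_mul_of_nonneg_left hC2 (by positivity)
    have : 0 ≤ t ^ 12 * T ^ 4 := by positivity
    linear_combination (1 / 9) * h + (1 / 27) * h3 + (10000 - 65536 / 27) * this
theorem card_le_of_injOn_box {α : Type*} (S : Finset α) (f : α → ℤ × ℤ × ℤ × ℤ)
    (hf : Set.InjOn f S) {r₁ r₂ r₃ r₄ : ℝ} (h₁ : 1 ≤ r₁) (h₂ : 1 ≤ r₂) (h₃ : 1 ≤ r₃) (h₄ : 1 ≤ r₄)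
    (hb : ∀ v ∈ S, |((f v).1 : ℝ)| ≤ r₁ ∧ |((f v).2.1 : ℝ)| ≤ r₂ ∧ |((f v).2.2.1 : ℝ)| ≤ r₃ ∧
      |((f v).2.2.2 : ℝ)| ≤ r₄) : (S.card : ℝ) ≤ 81 * (r₁ * r₂ * r₃ * r₄) := by
  let I : ℝ → Finset ℤ := fun r => Finset.Icc (-⌊r⌋) ⌊r⌋
  have hI : ∀ r : ℝ, 1 ≤ r → ((I r).card : ℝ) ≤ 3 * r := by
    intro r hr
    have h0 : 0 ≤ ⌊r⌋ := Int.floor_nonneg.2 (by linarith)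
    have : ((I r).card : ℤ) = 2 * ⌊r⌋ + 1 := by
      simp only [I, Int.card_Icc]
      omega
    have h : ((I r).card : ℝ) = 2 * (⌊r⌋ : ℝ) + 1 := by exact_mod_cast this
    rw [h]
    linarith [Int.floor_le r]
  have hmem : ∀ (r : ℝ) (n : ℤ), |(n : ℝ)| ≤ r → n ∈ I r := by
    intro r n h
    rw [abs_le] at h
    rw [Finset.mem_Icc, neg_le]
    exact ⟨Int.le_floor.2 (by push_cast; linarith), Int.le_floor.2 h.2⟩
  have hle : S.card ≤ (I r₁ ×ˢ I r₂ ×ˢ I r₃ ×ˢ I r₄).card := by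
    refine Finset.card_le_card_of_injOn f (fun v hv => ?_) hf
    obtain ⟨b1, b2, b3, b4⟩ := hb v hv
    simp only [Finset.coe_product, Set.mem_prod, Finset.mem_coe]
    exact ⟨hmem _ _ b1, hmem _ _ b2, hmem _ _ b3, hmem _ _ b4⟩
  simp only [Finset.card_product] at hle
  have hle' : (S.card : ℝ) ≤ (I r₁).card * ((I r₂).card * ((I r₃).card * (I r₄).card)) := by
    exact_mod_cast hle
  refine hle'.trans ?_
  have := hI _ h₁
  have := hI _ h₂
  have := hI _ h₃
  have := hI _ h₄
  calc ((I r₁).card : ℝ) * ((I r₂).card * ((I r₃).card * (I r₄).card))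
      ≤ (3 * r₁) * ((3 * r₂) * ((3 * r₃) * (3 * r₄))) := by gcongr
    _ = _ := by ring

theorem card_cusp_level_le {T t : ℝ} (hT : 1 ≤ T) (ht : 1 ≤ t) (S : Finset (ℤ × ℤ × ℤ × ℤ))
    (hS : ∀ v ∈ S, IsReducedForm (T ^ 4) v)
    (h1 : ∀ v ∈ S, t ^ 4 * ((v.2.1 ^ 2 - v.1 * v.2.2.1 : ℤ) : ℝ) ≤
      (v.2.2.1 ^ 2 - v.2.1 * v.2.2.2 : ℤ))
    (h2 : ∀ v ∈ S, ((v.2.2.1 ^ 2 - v.2.1 * v.2.2.2 : ℤ) : ℝ) ≤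
      16 * t ^ 4 * (v.2.1 ^ 2 - v.1 * v.2.2.1 : ℤ)) :
    (S.card : ℝ) ≤ 50000 * T ^ 4 / t ^ 2 := by
  classical
  have hT0 : 0 < T := by linarith
  have ht0 : 0 < t := by linarith
  have hApos : ∀ v ∈ S, 0 < v.2.1 ^ 2 - v.1 * v.2.2.1 := by
    rintro ⟨a, b, c, d⟩ hv
    obtain ⟨-, hB0, hBA, hAC, hneg, -⟩ := hS _ hv
    simp only at hB0 hBA hAC hneg ⊢
    by_contra hcon
    have hA0 : b ^ 2 - a * c = 0 := by linarith
    have hB0' : b * c - a * d = 0 := by linarith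
    unfold hessDisc at hneg
    rw [hA0, hB0'] at hneg
    norm_num at hneg
  have hbd : ∀ v ∈ S, |(v.1 : ℝ)| * t ^ 3 ≤ 2 * T ∧ |(v.2.1 : ℝ)| * t ≤ 2 * T ∧
      |(v.2.2.1 : ℝ)| ≤ 4 * t * T ∧ |(v.2.2.2 : ℝ)| ≤ 10 * t ^ 3 * T := by
    intro v hv
    have hA := hApos v hv
    obtain ⟨-, hB0, hBA, hAC, -, hX⟩ := hS v hv
    have e1 := h1 v hv
    have e2 := h2 v hv
    refine coeff_bounds_of_reduced hT0 ht (by exact_mod_cast hA) (by exact_mod_cast hB0)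
      (by exact_mod_cast hBA) (by exact_mod_cast hAC) ?_ (by exact_mod_cast e1)
      (by exact_mod_cast e2)
    refine le_trans (le_of_eq ?_) hX
    simp [hessDisc]
  rcases S.eq_empty_or_nonempty with rfl | ⟨v₀, hv₀⟩
  · simp only [Finset.card_empty, Nat.cast_zero]
    positivity
  have hr1 : 1 ≤ 2 * T / t ^ 3 := by
    rw [le_div_iff₀ (by positivity), one_mul]
    have h := (hbd v₀ hv₀).1
    have ha : (1 : ℝ) ≤ |(v₀.1 : ℝ)| := by exact_mod_cast Int.one_le_abs (hS v₀ hv₀).1.ne'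
    nlinarith [pow_pos ht0 3]
  have hr2 : 1 ≤ 2 * T / t := by
    refine hr1.trans (div_le_div_of_nonneg_left (by positivity) ht0 ?_)
    exact le_self_pow₀ ht (by norm_num)
  have quot : ∀ (r : ℝ) (x y : ℤ), 0 < y → 0 ≤ x → (x : ℝ) ≤ r * y → |((x / y : ℤ) : ℝ)| ≤ r := by
    intro r x y hy hx h
    have h0 : 0 ≤ x / y := Int.ediv_nonneg hx hy.le
    have hy' : (0 : ℝ) < y := by exact_mod_cast hy
    rw [abs_of_nonneg (by exact_mod_cast h0)]
    have : ((x / y * y : ℤ) : ℝ) ≤ x := by exact_mod_cast Int.ediv_mul_le x hy.ne'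
    push_cast at this
    nlinarith
  rw [← Finset.card_filter_add_card_filter_not (s := S)
    (fun v => v.2.1 ^ 2 - v.1 * v.2.2.1 ≤ 2 * v.2.1 ^ 2)]
  have hcase1 : ((S.filter fun v => v.2.1 ^ 2 - v.1 * v.2.2.1 ≤ 2 * v.2.1 ^ 2).card : ℝ) ≤
      81 * ((2 * T / t ^ 3) * (2 * T / t) * (10 * t ^ 3 * T) * (4 * T / t)) := by
    refine card_le_of_injOn_box _
      (fun v => (v.1, v.2.1, v.2.2.2, (v.2.1 * v.2.2.1 - v.1 * v.2.2.2) / |v.2.1|)) ?_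
        hr1 hr2 ?_ ?_ ?_
    · rintro ⟨a, b, c, d⟩ hv ⟨a', b', c', d'⟩ hv' h
      simp only [Prod.mk.injEq] at h
      obtain ⟨rfl, rfl, rfl, h⟩ := h
      have hb : b ≠ 0 := by
        rintro rfl
        have hv := Finset.mem_filter.1 (Finset.mem_coe.1 hv)
        have := hApos _ hv.1
        have := hv.2
        simp only at *
        omega
      have e : ∀ x : ℤ, (b * x - a * d) / |b| = b.sign * x + -(a * d) / |b| := by
        intro x
        have hb' : b = b.sign * |b| := (Int.sign_mul_abs b).symm
        have : b * x - a * d = -(a * d) + b.sign * x * |b| := by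
          nth_rewrite 1 [hb']
          ring
        rw [this, Int.add_mul_ediv_right _ _ (abs_ne_zero.2 hb)]
        ring
      rw [e, e] at h
      have : c = c' := by
        have h' : b.sign * c = b.sign * c' := by linarith
        exact mul_left_cancel₀ (fun h0 => hb (Int.sign_eq_zero_iff_zero.1 h0)) h'
      rw [this]
    · have : 1 ≤ t ^ 3 := one_le_pow₀ ht
      nlinarith
    · calc (1 : ℝ) ≤ 2 * T / t := hr2
        _ ≤ 4 * T / t := by gcongr; norm_num
    · intro v hv
      obtain ⟨hv, hA2⟩ := Finset.mem_filter.1 hv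
      obtain ⟨b1, b2, -, b4⟩ := hbd v hv
      have hA := hApos v hv
      obtain ⟨-, hB0, hBA, -⟩ := hS v hv
      have hb : v.2.1 ≠ 0 := by
        intro h
        rw [h] at hA2 hA
        linarith
      refine ⟨by rwa [le_div_iff₀ (by positivity)], by rwa [le_div_iff₀ ht0], b4,
        quot _ _ _ (abs_pos.2 hb) hB0 ?_⟩
      have h' : ((v.2.1 * v.2.2.1 - v.1 * v.2.2.2 : ℤ) : ℝ) ≤ 2 * |(v.2.1 : ℝ)| ^ 2 := by
        rw [sq_abs]
        exact_mod_cast hBA.trans hA2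
      have h'' : |(v.2.1 : ℝ)| ≤ 2 * T / t := by rwa [le_div_iff₀ ht0]
      calc ((v.2.1 * v.2.2.1 - v.1 * v.2.2.2 : ℤ) : ℝ) ≤ 2 * |(v.2.1 : ℝ)| ^ 2 := h'
        _ = 2 * |(v.2.1 : ℝ)| * |(v.2.1 : ℝ)| := by ring
        _ ≤ 2 * (2 * T / t) * |(v.2.1 : ℝ)| := by gcongr
        _ = 4 * T / t * ((|v.2.1| : ℤ) : ℝ) := by push_cast; ring
  have hcase2 : ((S.filter fun v => ¬ v.2.1 ^ 2 - v.1 * v.2.2.1 ≤ 2 * v.2.1 ^ 2).card : ℝ) ≤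
      81 * ((2 * T / t ^ 3) * (2 * T / t) * (4 * t * T) * (8 * t * T)) := by
    refine card_le_of_injOn_box _
      (fun v => (v.1, v.2.1, v.2.2.1, (v.2.1 * v.2.2.1 - v.1 * v.2.2.2) / v.1)) ?_ hr1 hr2 ?_ ?_ ?_
    · rintro ⟨a, b, c, d⟩ hv ⟨a', b', c', d'⟩ hv' h
      simp only [Prod.mk.injEq] at h
      obtain ⟨rfl, rfl, rfl, h⟩ := h
      have ha : a ≠ 0 := (hS _ (Finset.mem_filter.1 (Finset.mem_coe.1 hv)).1).1.ne'
      have e : ∀ x : ℤ, (b * c - a * x) / a = (b * c) / a - x := by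
        intro x
        have : b * c - a * x = b * c + a * (-x) := by ring
        rw [this, Int.add_mul_ediv_left _ _ ha]
        ring
      rw [e, e] at h
      have : d = d' := by linarith
      rw [this]
    · nlinarith
    · nlinarith
    · intro v hv
      obtain ⟨hv, hA2⟩ := Finset.mem_filter.1 hv
      obtain ⟨b1, b2, b3, -⟩ := hbd v hv
      obtain ⟨ha, hB0, hBA, -⟩ := hS v hv
      have ha' : (0 : ℝ) < v.1 := by exact_mod_cast ha
      refine ⟨by rwa [le_div_iff₀ (by positivity)], by rwa [le_div_iff₀ ht0], b3,
        quot _ _ _ ha hB0 ?_⟩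
      have h' : v.2.1 * v.2.2.1 - v.1 * v.2.2.2 ≤ 2 * |v.2.2.1| * v.1 := by
        nlinarith [neg_abs_le v.2.2.1]
      calc ((v.2.1 * v.2.2.1 - v.1 * v.2.2.2 : ℤ) : ℝ) ≤ 2 * |(v.2.2.1 : ℝ)| * v.1 := by
            exact_mod_cast h'
        _ ≤ 2 * (4 * t * T) * v.1 := by gcongr
        _ = _ := by ring
  push_cast
  refine (add_le_add hcase1 hcase2).trans ?_
  have e : 81 * ((2 * T / t ^ 3) * (2 * T / t) * (10 * t ^ 3 * T) * (4 * T / t)) +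
      81 * ((2 * T / t ^ 3) * (2 * T / t) * (4 * t * T) * (8 * t * T)) = 23328 * T ^ 4 / t ^ 2 := by
    field_simp
    ring
  rw [e]
  gcongr
  norm_num
/-- The region of reduced forms of discriminant at most one, truncated to a box. -/
def reducedRegion (R : ℝ) : Set (ℝ × ℝ × ℝ × ℝ) :=
  {v | |v.1| ≤ R ∧ |v.2.1| ≤ R ∧ |v.2.2.1| ≤ R ∧ |v.2.2.2| ≤ R ∧ 0 ≤ v.1 ∧
    0 ≤ v.2.1 * v.2.2.1 - v.1 * v.2.2.2 ∧
    v.2.1 * v.2.2.1 - v.1 * v.2.2.2 ≤ v.2.1 ^ 2 - v.1 * v.2.2.1 ∧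
    v.2.1 ^ 2 - v.1 * v.2.2.1 ≤ v.2.2.1 ^ 2 - v.2.1 * v.2.2.2 ∧
    -hessDisc v.1 v.2.1 v.2.2.1 v.2.2.2 ≤ 1}

theorem isCompact_reducedRegion (R : ℝ) : IsCompact (reducedRegion R) := by
  refine IsCompact.of_isClosed_subset (isCompact_Icc (a := ((-R, -R, -R, -R) : ℝ × ℝ × ℝ × ℝ))
    (b := (R, R, R, R))) ?_ ?_
  · unfold reducedRegion hessDisc
    simp only [Set.ofPred_and]
    repeat' refine IsClosed.inter ?_ ?_
    all_goals exact isClosed_le (by fun_prop) (by fun_prop)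
  · rintro ⟨a, b, c, d⟩ ⟨h1, h2, h3, h4, -⟩
    simp only [abs_le] at h1 h2 h3 h4
    exact ⟨⟨h1.1, h2.1, h3.1, h4.1⟩, ⟨h1.2, h2.2, h3.2, h4.2⟩⟩

set_option maxHeartbeats 1000000 in
theorem card_reduced_sieved_forms_le {V : ℝ} (hV : ∀ R, (volume (reducedRegion R)).toReal ≤ V)
    (E : Finset (ℤ × ℤ)) {k : ℕ}
    (hE : (Finset.univ.filter fun v : ZMod 4 × ZMod 4 × ZMod 4 × ZMod 4 =>
      hessCond E v.1 v.2.1 v.2.2.1 v.2.2.2).card = k) {ε : ℝ} (hε : 0 < ε) :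
    ∃ T₀ : ℝ, 0 < T₀ ∧ ∀ T : ℝ, T₀ ≤ T → ∀ S : Finset (ℤ × ℤ × ℤ × ℤ),
      (∀ v ∈ S, IsReducedForm (T ^ 4) v) →
      (∀ v ∈ S, hessCond E (v.1 : ZMod 4) v.2.1 v.2.2.1 v.2.2.2) →
      (∀ v ∈ S, hessDisc v.1 v.2.1 v.2.2.1 v.2.2.2 % 3 = 2) →
      (∀ v ∈ S, ∀ p : ℕ, p.Prime → 5 ≤ p → ¬ (p : ℤ) ^ 2 ∣ hessDisc v.1 v.2.1 v.2.2.1 v.2.2.2) →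
      (S.card : ℝ) ≤ (3 * k / (32 * Real.pi ^ 4) * V + ε) * T ^ 4 := by
  classical
  obtain ⟨k₀, hk₀⟩ : ∃ k₀ : ℕ, 100000 * (1 / 4 : ℝ) ^ k₀ ≤ ε / 2 := by
    obtain ⟨n, hn⟩ := exists_pow_lt_of_lt_one (show 0 < ε / 200000 by positivity)
      (show (1 / 4 : ℝ) < 1 by norm_num)
    exact ⟨n, by linarith⟩
  obtain ⟨T₀, hT₀, H⟩ := card_sieved_forms_le (isCompact_reducedRegion (10 * 8 ^ k₀)) E hE
    (half_pos hε)
  refine ⟨max 1 T₀, by positivity, fun T hT S hS h2 h3 h5 => ?_⟩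
  have hT1 : 1 ≤ T := (le_max_left _ _).trans hT
  have hT0 : 0 < T := by linarith
  let lv : ℤ × ℤ × ℤ × ℤ → ℕ := fun v =>
    Nat.log 16 ((v.2.2.1 ^ 2 - v.2.1 * v.2.2.2) / (v.2.1 ^ 2 - v.1 * v.2.2.1)).toNat
  have hApos : ∀ v ∈ S, 0 < v.2.1 ^ 2 - v.1 * v.2.2.1 := by
    rintro ⟨a, b, c, d⟩ hv
    obtain ⟨-, hB0, hBA, hAC, hneg, -⟩ := hS _ hv
    simp only at hB0 hBA hAC hneg ⊢
    by_contra hcon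
    have hA0 : b ^ 2 - a * c = 0 := by linarith
    have hB0' : b * c - a * d = 0 := by linarith
    unfold hessDisc at hneg
    rw [hA0, hB0'] at hneg
    norm_num at hneg
  have hlv : ∀ v ∈ S, 16 ^ lv v * (v.2.1 ^ 2 - v.1 * v.2.2.1) ≤ v.2.2.1 ^ 2 - v.2.1 * v.2.2.2 ∧
      v.2.2.1 ^ 2 - v.2.1 * v.2.2.2 ≤ 16 * 16 ^ lv v * (v.2.1 ^ 2 - v.1 * v.2.2.1) := by
    intro v hv
    have hA := hApos v hv
    obtain ⟨-, -, -, hAC, -⟩ := hS v hv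
    simp only [lv]
    set A := v.2.1 ^ 2 - v.1 * v.2.2.1
    set C := v.2.2.1 ^ 2 - v.2.1 * v.2.2.2
    have hq : 1 ≤ C / A := (Int.le_ediv_iff_mul_le hA).2 (by linarith)
    have hq' : ((C / A).toNat : ℤ) = C / A := Int.toNat_of_nonneg (by linarith)
    have l1 : (16 : ℤ) ^ Nat.log 16 (C / A).toNat ≤ C / A := by
      rw [← hq']
      have h := Nat.pow_log_le_self 16 (x := (C / A).toNat) (by omega)
      rw [Int.toNat_natCast]
      exact_mod_cast h
    have l2 : C / A < (16 : ℤ) ^ (Nat.log 16 (C / A).toNat + 1) := by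
      rw [← hq']
      have h := Nat.lt_pow_succ_log_self (b := 16) (by norm_num) (C / A).toNat
      rw [Int.toNat_natCast]
      exact_mod_cast h
    refine ⟨(Int.le_ediv_iff_mul_le hA).1 l1, ?_⟩
    have := (Int.ediv_lt_iff_lt_mul hA).1 l2
    rw [pow_succ] at this
    linarith
  have hlvR : ∀ v ∈ S, ((2 : ℝ) ^ lv v) ^ 4 * ((v.2.1 ^ 2 - v.1 * v.2.2.1 : ℤ) : ℝ) ≤
      (v.2.2.1 ^ 2 - v.2.1 * v.2.2.2 : ℤ) ∧ ((v.2.2.1 ^ 2 - v.2.1 * v.2.2.2 : ℤ) : ℝ) ≤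
      16 * (2 ^ lv v) ^ 4 * (v.2.1 ^ 2 - v.1 * v.2.2.1 : ℤ) := by
    intro v hv
    have e : ((2 : ℝ) ^ lv v) ^ 4 = 16 ^ lv v := by
      rw [← pow_mul, mul_comm, pow_mul]; norm_num
    rw [e]
    obtain ⟨l1, l2⟩ := hlv v hv
    exact ⟨by exact_mod_cast l1, by exact_mod_cast l2⟩
  have hbody : ((S.filter fun v => lv v < k₀).card : ℝ) ≤
      (3 * k / (32 * Real.pi ^ 4) * V + ε / 2) * T ^ 4 := by
    refine (H T ((le_max_right _ _).trans hT) _ ?_ (fun v hv => h2 v (Finset.mem_filter.1 hv).1)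
      (fun v hv => h3 v (Finset.mem_filter.1 hv).1)
      (fun v hv => h5 v (Finset.mem_filter.1 hv).1)).trans ?_
    · intro v hv
      obtain ⟨hv, hlt⟩ := Finset.mem_filter.1 hv
      have hA := hApos v hv
      obtain ⟨l1, l2⟩ := hlvR v hv
      obtain ⟨ha, hB0, hBA, hAC, -, hX⟩ := hS v hv
      have ha' : (0 : ℝ) < v.1 := by exact_mod_cast ha
      have hB0' : (0 : ℝ) ≤ v.2.1 * v.2.2.1 - v.1 * v.2.2.2 := by exact_mod_cast hB0
      have hBA' : (v.2.1 * v.2.2.1 - v.1 * v.2.2.2 : ℝ) ≤ v.2.1 ^ 2 - v.1 * v.2.2.1 := by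
        exact_mod_cast hBA
      have hAC' : (v.2.1 ^ 2 - v.1 * v.2.2.1 : ℝ) ≤ v.2.2.1 ^ 2 - v.2.1 * v.2.2.2 := by
        exact_mod_cast hAC
      have hX' : -hessDisc (v.1 : ℝ) v.2.1 v.2.2.1 v.2.2.2 ≤ T ^ 4 := by
        refine le_trans (le_of_eq ?_) hX
        simp [hessDisc]
      have ht : (1 : ℝ) ≤ 2 ^ lv v := one_le_pow₀ (by norm_num)
      obtain ⟨b1, b2, b3, b4⟩ := coeff_bounds_of_reduced hT0 ht (by exact_mod_cast hA) hB0' hBA'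
        hAC' hX' (by exact_mod_cast l1) (by exact_mod_cast l2)
      have t3 : ((2 : ℝ) ^ lv v) ^ 3 ≤ 8 ^ k₀ := by
        have e : ((2 : ℝ) ^ lv v) ^ 3 = 8 ^ lv v := by
          rw [← pow_mul, mul_comm, pow_mul]; norm_num
        rw [e]
        exact pow_le_pow_right₀ (by norm_num) hlt.le
      have t1 : (2 : ℝ) ^ lv v ≤ 8 ^ k₀ := (le_self_pow₀ ht (by norm_num)).trans t3
      have t0 : (1 : ℝ) ≤ (2 ^ lv v) ^ 3 := one_le_pow₀ ht
      have hR1 : (1 : ℝ) ≤ 8 ^ k₀ := t0.trans t3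
      have hdiv : ∀ x : ℝ, |x| ≤ 10 * 8 ^ k₀ * T → |x / T| ≤ 10 * 8 ^ k₀ := fun x hx => by
        rw [abs_div, abs_of_pos hT0]
        exact (div_le_iff₀ hT0).2 hx
      have eA : ((v.2.1 : ℝ) / T) ^ 2 - v.1 / T * (v.2.2.1 / T) =
          (v.2.1 ^ 2 - v.1 * v.2.2.1) / T ^ 2 := by field_simp
      have eB : (v.2.1 : ℝ) / T * (v.2.2.1 / T) - v.1 / T * (v.2.2.2 / T) =
          (v.2.1 * v.2.2.1 - v.1 * v.2.2.2) / T ^ 2 := by field_simp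
      have eC : ((v.2.2.1 : ℝ) / T) ^ 2 - v.2.1 / T * (v.2.2.2 / T) =
          (v.2.2.1 ^ 2 - v.2.1 * v.2.2.2) / T ^ 2 := by field_simp
      refine ⟨hdiv _ ?_, hdiv _ ?_, hdiv _ ?_, hdiv _ ?_, by positivity, ?_, ?_, ?_, ?_⟩
      · nlinarith [abs_nonneg (v.1 : ℝ)]
      · nlinarith [abs_nonneg (v.2.1 : ℝ)]
      · nlinarith [abs_nonneg (v.2.2.1 : ℝ)]
      · nlinarith [abs_nonneg (v.2.2.2 : ℝ)]
      · simp only [eB]; positivity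
      · simp only [eA, eB]; gcongr
      · simp only [eA, eC]; gcongr
      · have : hessDisc ((v.1 : ℝ) / T) (v.2.1 / T) (v.2.2.1 / T) (v.2.2.2 / T) =
            hessDisc (v.1 : ℝ) v.2.1 v.2.2.1 v.2.2.2 / T ^ 4 := by
          unfold hessDisc; field_simp
        simp only [this]
        rw [← neg_div, div_le_one (by positivity)]
        exact hX'
    · have := hV (10 * 8 ^ k₀)
      gcongr
  have hcusp : ((S.filter fun v => ¬ lv v < k₀).card : ℝ) ≤ ε / 2 * T ^ 4 := by
    set S' := S.filter fun v => ¬ lv v < k₀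
    obtain ⟨N, hN⟩ : ∃ N : ℕ, ∀ v ∈ S', lv v < N := by
      refine ⟨S'.sup lv + 1, fun v hv => Nat.lt_succ_of_le (Finset.le_sup (f := lv) hv)⟩
    have hmaps : ∀ v ∈ S', lv v ∈ Finset.Ico k₀ N := fun v hv =>
      Finset.mem_Ico.2 ⟨not_lt.1 (Finset.mem_filter.1 hv).2, hN v hv⟩
    have hfib : ∀ j ∈ Finset.Ico k₀ N, ((S'.filter fun v => lv v = j).card : ℝ) ≤
        50000 * T ^ 4 * (1 / 4) ^ j := by
      intro j _
      have hsub : ∀ v ∈ S'.filter fun v => lv v = j, v ∈ S ∧ lv v = j := fun v hv =>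
        ⟨(Finset.mem_filter.1 (Finset.mem_filter.1 hv).1).1, (Finset.mem_filter.1 hv).2⟩
      have := card_cusp_level_le hT1 (t := 2 ^ j) (one_le_pow₀ (by norm_num))
        (S'.filter fun v => lv v = j) (fun v hv => hS v (hsub v hv).1)
        (fun v hv => (hsub v hv).2 ▸ (hlvR v (hsub v hv).1).1)
        (fun v hv => (hsub v hv).2 ▸ (hlvR v (hsub v hv).1).2)
      refine this.trans (le_of_eq ?_)
      rw [← pow_mul, mul_comm j 2, pow_mul, div_eq_mul_inv, ← inv_pow]
      norm_num
    have hcard : (S'.card : ℝ) =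
        ∑ j ∈ Finset.Ico k₀ N, ((S'.filter fun v => lv v = j).card : ℝ) := by
      rw [Finset.card_eq_sum_card_fiberwise hmaps]
      push_cast
      rfl
    rw [hcard]
    refine (Finset.sum_le_sum hfib).trans ?_
    rw [← Finset.mul_sum]
    have hgeom : ∑ j ∈ Finset.Ico k₀ N, (1 / 4 : ℝ) ^ j ≤ 2 * (1 / 4) ^ k₀ := by
      refine (geom_sum_Ico_le_of_lt_one (by norm_num) (by norm_num)).trans ?_
      rw [div_le_iff₀ (by norm_num)]
      have : (0 : ℝ) < (1 / 4) ^ k₀ := by positivity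
      linarith
    have hT4 : 0 < T ^ 4 := by positivity
    calc 50000 * T ^ 4 * ∑ j ∈ Finset.Ico k₀ N, (1 / 4 : ℝ) ^ j
        ≤ 50000 * T ^ 4 * (2 * (1 / 4) ^ k₀) := by gcongr
      _ = 100000 * (1 / 4) ^ k₀ * T ^ 4 := by ring
      _ ≤ ε / 2 * T ^ 4 := by gcongr
  rw [← Finset.card_filter_add_card_filter_not (s := S) (fun v => lv v < k₀)]
  push_cast
  linarith

theorem lintegral_eq_mul_lintegral_comp_affine {f : ℝ → ENNReal} (hf : Measurable f)
    {k : ℝ} (hk : k ≠ 0) (m : ℝ) : ∫⁻ x, f x = ENNReal.ofReal |k| * ∫⁻ y, f (k * y + m) := by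
  conv_lhs => rw [← lintegral_add_right_eq_self f m, ← Real.smul_map_volume_mul_left hk]
  have hg : Measurable fun a => f (a + m) := hf.comp (measurable_add_const m)
  rw [lintegral_smul_measure, lintegral_map hg (measurable_const_mul k), smul_eq_mul]

theorem lintegral_Icc_ofReal_inv {l h : ℝ} (hl : 0 < l) (hlh : l ≤ h) :
    ∫⁻ a in Set.Icc l h, ENNReal.ofReal a⁻¹ = ENNReal.ofReal (Real.log (h / l)) := by
  rw [← integral_inv_of_pos hl (hl.trans_le hlh), intervalIntegral.integral_of_le hlh,
    ← integral_Icc_eq_integral_Ioc, ofReal_integral_eq_lintegral_ofReal]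
  · refine ContinuousOn.integrableOn_Icc ?_
    exact continuousOn_inv₀.mono fun x hx => (hl.trans_le hx.1).ne'
  · filter_upwards [ae_restrict_mem measurableSet_Icc] with x hx
    exact inv_nonneg.2 (hl.le.trans hx.1)

theorem lintegral_ofReal_div_sq_add_sq {r : ℝ} (hr : 0 < r) :
    ∫⁻ u : ℝ, ENNReal.ofReal (r / (r ^ 2 + u ^ 2)) = ENNReal.ofReal Real.pi := by
  rw [lintegral_eq_mul_lintegral_comp_affine (by fun_prop) hr.ne' 0, ← integral_univ_inv_one_add_sq,
    ofReal_integral_eq_lintegral_ofReal integrable_inv_one_add_sq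
      (Filter.Eventually.of_forall fun x => by positivity),
    ← lintegral_const_mul _ (by fun_prop)]
  refine lintegral_congr fun u => ?_
  rw [← ENNReal.ofReal_mul (abs_nonneg _), abs_of_pos hr]
  congr 1
  field_simp
  ring

theorem half_log_div_eq_lintegral {s u : ℝ} (hs : 0 < s) (hs1 : s ≤ 1) :
    ENNReal.ofReal (1 / 2 * Real.log ((1 + u ^ 2) / (s ^ 2 + u ^ 2))) =
      ∫⁻ r in Set.Icc s 1, ENNReal.ofReal (r / (r ^ 2 + u ^ 2)) := by
  have hpos : ∀ r ∈ Set.Icc s 1, 0 < r ^ 2 + u ^ 2 := fun r hr => by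
    have := hs.trans_le hr.1
    positivity
  have hcont : ContinuousOn (fun r : ℝ => r / (r ^ 2 + u ^ 2)) (Set.Icc s 1) :=
    continuousOn_id.div (by fun_prop) fun r hr => (hpos r hr).ne'
  have hFTC : ∫ r in s..1, r / (r ^ 2 + u ^ 2) =
      1 / 2 * Real.log (1 ^ 2 + u ^ 2) - 1 / 2 * Real.log (s ^ 2 + u ^ 2) := by
    refine intervalIntegral.integral_eq_sub_of_hasDerivAt
      (f := fun r => 1 / 2 * Real.log (r ^ 2 + u ^ 2)) (fun r hr => ?_) ?_
    · rw [Set.uIcc_of_le hs1] at hr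
      have h := (((hasDerivAt_pow 2 r).add_const (u ^ 2)).log (hpos r hr).ne').const_mul (1 / 2)
      exact h.congr_deriv (by push_cast; ring)
    · exact ContinuousOn.intervalIntegrable (by rwa [Set.uIcc_of_le hs1])
  have h1 := hpos 1 ⟨hs1, le_rfl⟩
  have h2 := hpos s ⟨le_rfl, hs1⟩
  rw [one_pow] at h1 hFTC
  rw [Real.log_div h1.ne' h2.ne', mul_sub, ← hFTC, intervalIntegral.integral_of_le hs1,
    ← integral_Icc_eq_integral_Ioc, ofReal_integral_eq_lintegral_ofReal hcont.integrableOn_Icc]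
  filter_upwards [ae_restrict_mem measurableSet_Icc] with r hr
  exact div_nonneg (hs.le.trans hr.1) (hpos r hr).le

theorem lintegral_half_log_le {s : ℝ} (hs : 0 < s) :
    ∫⁻ u : ℝ, ENNReal.ofReal (1 / 2 * Real.log ((1 + u ^ 2) / (s ^ 2 + u ^ 2))) ≤
      ENNReal.ofReal (Real.pi * (1 - s)) := by
  rcases le_or_gt s 1 with hs1 | hs1
  · simp only [half_log_div_eq_lintegral hs hs1]
    rw [lintegral_lintegral_swap (by fun_prop)]
    calc ∫⁻ r in Set.Icc s 1, ∫⁻ u : ℝ, ENNReal.ofReal (r / (r ^ 2 + u ^ 2))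
        = ∫⁻ r in Set.Icc s 1, ENNReal.ofReal Real.pi :=
          setLIntegral_congr_fun measurableSet_Icc fun r hr =>
            lintegral_ofReal_div_sq_add_sq (hs.trans_le hr.1)
      _ = ENNReal.ofReal (Real.pi * (1 - s)) := by
          rw [setLIntegral_const, Real.volume_Icc, ENNReal.ofReal_mul Real.pi_pos.le]
      _ ≤ _ := le_rfl
  · have : ∀ u : ℝ, ENNReal.ofReal (1 / 2 * Real.log ((1 + u ^ 2) / (s ^ 2 + u ^ 2))) = 0 := by
      intro u
      refine ENNReal.ofReal_of_nonpos ?_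
      refine mul_nonpos_of_nonneg_of_nonpos (by norm_num) (Real.log_nonpos (by positivity) ?_)
      rw [div_le_one (by positivity)]
      nlinarith
    simp only [this, lintegral_zero]
    exact zero_le

theorem lintegral_inv_mul_indicator_le {A δ₀ u : ℝ} (hA : 0 < A) (hδ : 0 < δ₀) :
    ∫⁻ a in {a : ℝ | 0 < a ∧ δ₀ ≤ 4 * A ^ 3 / a ^ 2 - u ^ 2 ∧ 4 * A ^ 3 / a ^ 2 - u ^ 2 ≤ 1},
      ENNReal.ofReal a⁻¹ ≤
      ENNReal.ofReal (1 / 2 * Real.log ((1 + u ^ 2) / (δ₀ + u ^ 2))) := by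
  set l := √(4 * A ^ 3 / (1 + u ^ 2)) with hl
  set h := √(4 * A ^ 3 / (δ₀ + u ^ 2)) with hh
  have hl0 : 0 < l := Real.sqrt_pos.2 (by positivity)
  have hsub : {a : ℝ | 0 < a ∧ δ₀ ≤ 4 * A ^ 3 / a ^ 2 - u ^ 2 ∧ 4 * A ^ 3 / a ^ 2 - u ^ 2 ≤ 1} ⊆
      Set.Icc l h := by
    rintro a ⟨ha, h1, h2⟩
    have ha2 : 0 < a ^ 2 := by positivity
    constructor
    · refine Real.sqrt_le_iff.2 ⟨ha.le, ?_⟩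
      rw [div_le_iff₀ (by positivity)]
      have : 4 * A ^ 3 / a ^ 2 ≤ 1 + u ^ 2 := by linarith
      rw [div_le_iff₀ ha2] at this
      linarith
    · refine Real.le_sqrt_of_sq_le ?_
      rw [le_div_iff₀ (by positivity)]
      have : δ₀ + u ^ 2 ≤ 4 * A ^ 3 / a ^ 2 := by linarith
      rw [le_div_iff₀ ha2] at this
      linarith
  rcases le_or_gt l h with hlh | hlh
  · refine (lintegral_mono_set hsub).trans ?_
    rw [lintegral_Icc_ofReal_inv hl0 hlh]
    refine le_of_eq ?_
    congr 1
    rw [hl, hh, ← Real.sqrt_div (by positivity), Real.log_sqrt (by positivity)]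
    have : 4 * A ^ 3 / (δ₀ + u ^ 2) / (4 * A ^ 3 / (1 + u ^ 2)) = (1 + u ^ 2) / (δ₀ + u ^ 2) := by
      field_simp
    rw [this]
    ring
  · rw [Set.Icc_eq_empty (not_le.2 hlh)] at hsub
    rw [Set.subset_empty_iff.1 hsub]
    simp

theorem lintegral_Ioi_ofReal_pi_mul_one_sub {y : ℝ} (hy : 0 < y) :
    ∫⁻ A in Set.Ioi 0, ENNReal.ofReal (Real.pi * (1 - 2 * A * y)) =
      ENNReal.ofReal (Real.pi / (4 * y)) := by
  have h1 : ∫⁻ A in Set.Ioi 0, ENNReal.ofReal (Real.pi * (1 - 2 * A * y)) =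
      ∫⁻ A in Set.Icc 0 (1 / (2 * y)), ENNReal.ofReal (Real.pi * (1 - 2 * A * y)) := by
    rw [← lintegral_indicator measurableSet_Ioi, ← lintegral_indicator measurableSet_Icc]
    refine lintegral_congr_ae ?_
    filter_upwards [compl_mem_ae_iff.2 (measure_singleton (0 : ℝ))] with A hA
    rcases lt_trichotomy A 0 with h | h | h
    · rw [Set.indicator_of_notMem (by simp [h.le]), Set.indicator_of_notMem (by simp [h])]
    · exact absurd h hA
    · rw [Set.indicator_of_mem (by exact h)]
      by_cases h' : A ≤ 1 / (2 * y)
      · rw [Set.indicator_of_mem (Set.mem_Icc.2 ⟨h.le, h'⟩)]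
      · rw [Set.indicator_of_notMem (fun hh => h' hh.2)]
        refine ENNReal.ofReal_of_nonpos ?_
        rw [not_le, div_lt_iff₀ (by positivity)] at h'
        exact mul_nonpos_of_nonneg_of_nonpos Real.pi_pos.le (by linarith)
  have hy2 : 0 ≤ 1 / (2 * y) := by positivity
  rw [h1, ← ofReal_integral_eq_lintegral_ofReal]
  · rw [integral_Icc_eq_integral_Ioc, ← intervalIntegral.integral_of_le hy2]
    congr 1
    rw [intervalIntegral.integral_eq_sub_of_hasDerivAt
      (f := fun A => Real.pi * (A - A ^ 2 * y)) (fun A _ => ?_)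
      (Continuous.intervalIntegrable (by fun_prop) _ _)]
    · field_simp
      ring
    · have h := (((hasDerivAt_id A).sub ((hasDerivAt_pow 2 A).mul_const y))).const_mul Real.pi
      exact h.congr_deriv (by push_cast; ring)
  · exact (Continuous.continuousOn (by fun_prop)).integrableOn_Icc
  · filter_upwards [ae_restrict_mem measurableSet_Icc] with A hA
    have := hA.2
    rw [le_div_iff₀ (by positivity)] at this
    exact mul_nonneg Real.pi_pos.le (by linarith)

theorem lintegral_Icc_pi_div_sqrt :
    ∫⁻ x in Set.Icc (0 : ℝ) (1 / 2), ENNReal.ofReal (Real.pi / (4 * √(1 - x ^ 2))) =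
      ENNReal.ofReal (Real.pi ^ 2 / 24) := by
  have hpos : ∀ x ∈ Set.Icc (0 : ℝ) (1 / 2), 0 < 1 - x ^ 2 := fun x hx => by
    nlinarith [hx.1, hx.2]
  have hcont : ContinuousOn (fun x : ℝ => Real.pi / (4 * √(1 - x ^ 2))) (Set.Icc 0 (1 / 2)) := by
    refine continuousOn_const.div (by fun_prop) fun x hx => ?_
    have := Real.sqrt_pos.2 (hpos x hx)
    positivity
  rw [← ofReal_integral_eq_lintegral_ofReal hcont.integrableOn_Icc]
  · rw [integral_Icc_eq_integral_Ioc, ← intervalIntegral.integral_of_le (by norm_num)]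
    congr 1
    rw [intervalIntegral.integral_eq_sub_of_hasDerivAt
      (f := fun x => Real.pi / 4 * Real.arcsin x)]
    · have h : Real.arcsin (1 / 2) = Real.pi / 6 := by
        rw [← Real.sin_pi_div_six]
        exact Real.arcsin_sin (by linarith [Real.pi_pos]) (by linarith [Real.pi_pos])
      rw [h, Real.arcsin_zero]
      ring
    · intro x hx
      rw [Set.uIcc_of_le (by norm_num : (0 : ℝ) ≤ 1 / 2)] at hx
      have h := (Real.hasDerivAt_arcsin (x := x) (by linarith [hx.1]) (by linarith [hx.2])).const_mul
        (Real.pi / 4)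
      refine h.congr_deriv ?_
      have := Real.sqrt_pos.2 (hpos x hx)
      field_simp
    · exact ContinuousOn.intervalIntegrable (by rwa [Set.uIcc_of_le (by norm_num)])
  · exact Filter.Eventually.of_forall fun x => by positivity

theorem lintegral_lintegral_pi_mul_one_sub_sqrt :
    ∫⁻ A in Set.Ioi (0 : ℝ), ∫⁻ B in Set.Icc 0 A,
      ENNReal.ofReal (1 / (2 * A)) * ENNReal.ofReal (Real.pi * (1 - √(4 * A ^ 2 - B ^ 2))) =
      ENNReal.ofReal (Real.pi ^ 2 / 24) := by
  have h1 : ∀ A ∈ Set.Ioi (0 : ℝ), ∫⁻ B in Set.Icc 0 A,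
      ENNReal.ofReal (1 / (2 * A)) * ENNReal.ofReal (Real.pi * (1 - √(4 * A ^ 2 - B ^ 2))) =
      ∫⁻ x in Set.Icc (0 : ℝ) (1 / 2),
        ENNReal.ofReal (Real.pi * (1 - 2 * A * √(1 - x ^ 2))) := by
    intro A hA
    have hA' : 0 < A := hA
    have hm : Measurable ((Set.Icc 0 A).indicator fun B => ENNReal.ofReal (1 / (2 * A)) *
        ENNReal.ofReal (Real.pi * (1 - √(4 * A ^ 2 - B ^ 2)))) :=
      Measurable.indicator (by fun_prop) measurableSet_Icc
    rw [← lintegral_indicator measurableSet_Icc, ← lintegral_indicator measurableSet_Icc,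
      lintegral_eq_mul_lintegral_comp_affine (k := 2 * A) hm (by positivity) 0,
      ← lintegral_const_mul' _ _ ENNReal.ofReal_ne_top]
    refine lintegral_congr fun x => ?_
    by_cases hx : x ∈ Set.Icc (0 : ℝ) (1 / 2)
    · rw [Set.indicator_of_mem hx, Set.indicator_of_mem, ← mul_assoc,
        ← ENNReal.ofReal_mul (abs_nonneg _), abs_of_pos (by positivity),
        mul_one_div_cancel (by positivity), ENNReal.ofReal_one, one_mul]
      · have : 4 * A ^ 2 - (2 * A * x + 0) ^ 2 = (2 * A) ^ 2 * (1 - x ^ 2) := by ring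
        rw [this, Real.sqrt_mul (by positivity), Real.sqrt_sq (by positivity)]
      · have := hx.1
        constructor
        · positivity
        · nlinarith [hx.2]
    · rw [Set.indicator_of_notMem hx, Set.indicator_of_notMem, mul_zero]
      contrapose! hx
      obtain ⟨h1, h2⟩ := hx
      constructor
      · by_contra! h
        nlinarith
      · by_contra! h
        nlinarith
  rw [setLIntegral_congr_fun measurableSet_Ioi h1, lintegral_lintegral_swap (by fun_prop),
    ← lintegral_Icc_pi_div_sqrt]
  refine setLIntegral_congr_fun measurableSet_Icc fun x hx => ?_
  exact lintegral_Ioi_ofReal_pi_mul_one_sub (Real.sqrt_pos.2 (by nlinarith [hx.1, hx.2]))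

/-- The region of reduced binary cubic forms with nonnegative leading coefficient. -/
def reducedCone : Set (ℝ × ℝ × ℝ × ℝ) :=
  {v | 0 ≤ v.1 ∧
    0 ≤ v.2.1 * v.2.2.1 - v.1 * v.2.2.2 ∧
    v.2.1 * v.2.2.1 - v.1 * v.2.2.2 ≤ v.2.1 ^ 2 - v.1 * v.2.2.1 ∧
    v.2.1 ^ 2 - v.1 * v.2.2.1 ≤ v.2.2.1 ^ 2 - v.2.1 * v.2.2.2 ∧
    -hessDisc v.1 v.2.1 v.2.2.1 v.2.2.2 ≤ 1}

/-- The region `reducedCone` in the coordinates `((a, b), (A, B))`. -/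
def hessRegion : Set ((ℝ × ℝ) × ℝ × ℝ) :=
  {v | 0 < v.1.1 ∧ 0 < v.2.1 ∧ 0 ≤ v.2.2 ∧ v.2.2 ≤ v.2.1 ∧
    4 * v.2.1 ^ 2 - v.2.2 ^ 2 ≤
      (4 * v.2.1 ^ 3 - (2 * v.2.1 * v.1.2 - v.1.1 * v.2.2) ^ 2) / v.1.1 ^ 2 ∧
    (4 * v.2.1 ^ 3 - (2 * v.2.1 * v.1.2 - v.1.1 * v.2.2) ^ 2) / v.1.1 ^ 2 ≤ 1}

theorem measurableSet_reducedCone : MeasurableSet reducedCone := by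
  unfold reducedCone hessDisc
  simp only [Set.ofPred_and]
  repeat' refine MeasurableSet.inter ?_ ?_
  all_goals exact measurableSet_le (by fun_prop) (by fun_prop)

theorem measurableSet_hessRegion : MeasurableSet hessRegion := by
  unfold hessRegion
  simp only [Set.ofPred_and]
  repeat' refine MeasurableSet.inter ?_ ?_
  all_goals first
    | exact measurableSet_le (by fun_prop) (by fun_prop)
    | exact measurableSet_lt (by fun_prop) (by fun_prop)

theorem mem_hessRegion_of_mem_reducedCone {a b A B : ℝ} (ha : a ≠ 0) (hA : A ≠ 0)
    (h : (a, b, (b ^ 2 - A) / a, (b * ((b ^ 2 - A) / a) - B) / a) ∈ reducedCone) :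
    ((a, b), (A, B)) ∈ hessRegion := by
  obtain ⟨h1, h2, h3, h4, h5⟩ := h
  dsimp only at h1 h2 h3 h4 h5
  have e1 : b * ((b ^ 2 - A) / a) - a * ((b * ((b ^ 2 - A) / a) - B) / a) = B := by
    field_simp
    ring
  have e2 : b ^ 2 - a * ((b ^ 2 - A) / a) = A := by
    field_simp
    ring
  have e3 : ∀ C, C = ((b ^ 2 - A) / a) ^ 2 - b * ((b * ((b ^ 2 - A) / a) - B) / a) →
      4 * A * C - B ^ 2 = (4 * A ^ 3 - (2 * A * b - a * B) ^ 2) / a ^ 2 := by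
    rintro C rfl
    field_simp
    ring
  unfold hessDisc at h5
  rw [e1] at h2 h3
  rw [e2] at h3 h4
  rw [e1, e2] at h5
  have e4 := e3 _ rfl
  have hA0 : 0 < A := lt_of_le_of_ne (h2.trans h3) hA.symm
  refine ⟨lt_of_le_of_ne h1 ha.symm, hA0, h2, h3, ?_, ?_⟩
  · dsimp only
    rw [← e4]
    nlinarith
  · dsimp only
    rw [← e4]
    linarith

theorem lintegral_lintegral_comp_hess {f : ℝ → ℝ → ENNReal} (hf : Measurable (Function.uncurry f))
    {a : ℝ} (ha : a ≠ 0) (b : ℝ) :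
    ∫⁻ c, ∫⁻ d, f c d = ∫⁻ A, ∫⁻ B, ENNReal.ofReal (1 / a ^ 2) *
      f ((b ^ 2 - A) / a) ((b * ((b ^ 2 - A) / a) - B) / a) := by
  have hk : -1 / a ≠ 0 := div_ne_zero (by norm_num) ha
  have h1 : ∀ c, ∫⁻ d, f c d =
      ENNReal.ofReal |-1 / a| * ∫⁻ B, f c (-1 / a * B + b * c / a) := fun c =>
    lintegral_eq_mul_lintegral_comp_affine (hf.comp (by fun_prop : Measurable fun d => (c, d)))
      hk _
  have hm : Measurable fun c => ∫⁻ d, f c d := hf.lintegral_prod_right'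
  rw [lintegral_eq_mul_lintegral_comp_affine hm hk (b ^ 2 / a),
    ← lintegral_const_mul' _ _ ENNReal.ofReal_ne_top]
  refine lintegral_congr fun A => ?_
  rw [h1, ← mul_assoc, ← ENNReal.ofReal_mul (abs_nonneg _),
    ← lintegral_const_mul' _ _ ENNReal.ofReal_ne_top]
  refine lintegral_congr fun B => ?_
  have e1 : -1 / a * A + b ^ 2 / a = (b ^ 2 - A) / a := by ring
  have e2 : |-1 / a| * |-1 / a| = 1 / a ^ 2 := by
    rw [abs_mul_abs_self]
    ring
  rw [e1, e2]
  congr 2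
  ring

theorem lintegral_prod_swap_pairs {f : (ℝ × ℝ) × ℝ × ℝ → ENNReal} (hf : Measurable f) :
    ∫⁻ a, ∫⁻ b, ∫⁻ A, ∫⁻ B, f ((a, b), (A, B)) = ∫⁻ A, ∫⁻ B, ∫⁻ a, ∫⁻ b, f ((a, b), (A, B)) := by
  have h1 : ∀ p, ∫⁻ A, ∫⁻ B, f (p, (A, B)) = ∫⁻ q, f (p, q) := fun p =>
    (lintegral_prod (fun q => f (p, q))
      (hf.comp (by fun_prop : Measurable fun q => (p, q))).aemeasurable).symm
  have h2 : ∀ q, ∫⁻ a, ∫⁻ b, f ((a, b), q) = ∫⁻ p, f (p, q) := fun q =>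
    (lintegral_prod (fun p => f (p, q))
      (hf.comp (by fun_prop : Measurable fun p => (p, q))).aemeasurable).symm
  simp only [h1, h2]
  have h3 := (lintegral_prod (μ := (volume : Measure ℝ)) (ν := (volume : Measure ℝ))
    (fun p => ∫⁻ q, f (p, q)) hf.lintegral_prod_right'.aemeasurable)
  have h4 := (lintegral_prod (μ := (volume : Measure ℝ)) (ν := (volume : Measure ℝ))
    (fun q => ∫⁻ p, f (p, q)) hf.lintegral_prod_left'.aemeasurable)
  rw [← h3, ← h4]
  exact lintegral_lintegral_swap hf.aemeasurable

theorem volume_reducedCone_le_lintegral : volume reducedCone ≤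
    ∫⁻ A, ∫⁻ B, ∫⁻ a, ∫⁻ b, ENNReal.ofReal (1 / a ^ 2) *
      hessRegion.indicator 1 ((a, b), (A, B)) := by
  have hm : Measurable (reducedCone.indicator (1 : ℝ × ℝ × ℝ × ℝ → ENNReal)) :=
    measurable_one.indicator measurableSet_reducedCone
  rw [← lintegral_prod_swap_pairs (f := fun v => ENNReal.ofReal (1 / v.1.1 ^ 2) *
    hessRegion.indicator 1 v) (by
      exact Measurable.mul (by fun_prop) (measurable_one.indicator measurableSet_hessRegion)),
    ← lintegral_indicator_one measurableSet_reducedCone, Measure.volume_eq_prod,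
    lintegral_prod _ hm.aemeasurable]
  refine lintegral_mono_ae ?_
  filter_upwards [compl_mem_ae_iff.2 (measure_singleton (0 : ℝ))] with a ha
  have hma : Measurable fun y => reducedCone.indicator (1 : ℝ × ℝ × ℝ × ℝ → ENNReal) (a, y) :=
    hm.comp (by fun_prop : Measurable fun y => (a, y))
  rw [Measure.volume_eq_prod, lintegral_prod _ hma.aemeasurable]
  refine lintegral_mono fun b => ?_
  have hmb : Measurable fun y => reducedCone.indicator (1 : ℝ × ℝ × ℝ × ℝ → ENNReal) (a, b, y) :=
    hma.comp (by fun_prop : Measurable fun y => (b, y))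
  rw [Measure.volume_eq_prod, lintegral_prod _ hmb.aemeasurable,
    lintegral_lintegral_comp_hess (f := fun c d => reducedCone.indicator 1 (a, b, c, d)) hmb ha b]
  refine lintegral_mono_ae ?_
  filter_upwards [compl_mem_ae_iff.2 (measure_singleton (0 : ℝ))] with A hA
  refine lintegral_mono fun B => ?_
  refine mul_le_mul_right ?_ _
  by_cases h : (a, b, (b ^ 2 - A) / a, (b * ((b ^ 2 - A) / a) - B) / a) ∈ reducedCone
  · rw [Set.indicator_of_mem (mem_hessRegion_of_mem_reducedCone ha hA h)]
    exact Set.indicator_le_self _ _ _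
  · rw [Set.indicator_of_notMem h]
    exact zero_le

theorem lintegral_hessRegion_slice_le {A B : ℝ} (hA : 0 < A) (hB : 0 ≤ B) (hBA : B ≤ A) :
    ∫⁻ a, ∫⁻ b, ENNReal.ofReal (1 / a ^ 2) * hessRegion.indicator 1 ((a, b), (A, B)) ≤
      ENNReal.ofReal (1 / (2 * A)) * ENNReal.ofReal (Real.pi * (1 - √(4 * A ^ 2 - B ^ 2))) := by
  have hδ : 0 < 4 * A ^ 2 - B ^ 2 := by nlinarith
  set S : ℝ → Set ℝ := fun u => {a : ℝ | 0 < a ∧ 4 * A ^ 2 - B ^ 2 ≤ 4 * A ^ 3 / a ^ 2 - u ^ 2 ∧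
    4 * A ^ 3 / a ^ 2 - u ^ 2 ≤ 1} with hS
  have hSm : MeasurableSet {p : ℝ × ℝ | p.1 ∈ S p.2} := by
    simp only [hS, Set.ofPred_and]
    refine MeasurableSet.inter (measurableSet_lt (by fun_prop) (by fun_prop))
      (MeasurableSet.inter ?_ ?_)
    all_goals exact measurableSet_le (by fun_prop) (by fun_prop)
  have hSm' : ∀ u, MeasurableSet (S u) := fun u =>
    (by fun_prop : Measurable fun a : ℝ => (a, u)) hSm
  have h1 : ∀ a, ∫⁻ b, ENNReal.ofReal (1 / a ^ 2) * hessRegion.indicator 1 ((a, b), (A, B)) ≤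
      ∫⁻ u, ENNReal.ofReal (1 / (2 * A)) *
        {p : ℝ × ℝ | p.1 ∈ S p.2}.indicator (fun p => ENNReal.ofReal p.1⁻¹) (a, u) := by
    intro a
    rcases le_or_gt a 0 with ha | ha
    · have : ∀ b, hessRegion.indicator (1 : (ℝ × ℝ) × ℝ × ℝ → ENNReal) ((a, b), (A, B)) = 0 := fun b =>
        Set.indicator_of_notMem (fun h => ha.not_gt h.1) _
      simp only [this, mul_zero, lintegral_zero]
      exact zero_le
    · have hm : Measurable fun b => ENNReal.ofReal (1 / a ^ 2) *
          hessRegion.indicator 1 ((a, b), (A, B)) :=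
        Measurable.const_mul ((measurable_one.indicator measurableSet_hessRegion).comp
          (by fun_prop : Measurable fun b => ((a, b), (A, B)))) _
      rw [lintegral_eq_mul_lintegral_comp_affine hm (k := a / (2 * A)) (by positivity)
        (a * B / (2 * A)), ← lintegral_const_mul' _ _ ENNReal.ofReal_ne_top]
      refine lintegral_mono fun u => ?_
      dsimp only
      by_cases h : ((a, a / (2 * A) * u + a * B / (2 * A)), (A, B)) ∈ hessRegion
      · rw [Set.indicator_of_mem h, Set.indicator_of_mem, Pi.one_apply, mul_one,
          ← ENNReal.ofReal_mul (abs_nonneg _), ← ENNReal.ofReal_mul (by positivity),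
          abs_of_pos (by positivity)]
        · refine ENNReal.ofReal_le_ofReal (le_of_eq ?_)
          field_simp
        · obtain ⟨-, -, -, -, h5, h6⟩ := h
          have e : (4 * A ^ 3 - (2 * A * (a / (2 * A) * u + a * B / (2 * A)) - a * B) ^ 2) / a ^ 2
              = 4 * A ^ 3 / a ^ 2 - u ^ 2 := by
            field_simp
            ring
          dsimp only at h5 h6
          rw [e] at h5 h6
          exact ⟨ha, h5, h6⟩
      · rw [Set.indicator_of_notMem h, mul_zero, mul_zero]
        exact zero_le
  refine (lintegral_mono h1).trans ?_
  have hm : Measurable ({p : ℝ × ℝ | p.1 ∈ S p.2}.indicator (fun p => ENNReal.ofReal p.1⁻¹)) :=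
    Measurable.indicator (by fun_prop) hSm
  simp only [lintegral_const_mul' _ _ ENNReal.ofReal_ne_top]
  gcongr
  rw [lintegral_lintegral_swap (f := fun a u =>
    {p : ℝ × ℝ | p.1 ∈ S p.2}.indicator (fun p => ENNReal.ofReal p.1⁻¹) (a, u)) hm.aemeasurable]
  have hs := Real.sqrt_pos.2 hδ
  refine le_trans (lintegral_mono fun u => ?_) (lintegral_half_log_le hs)
  rw [Real.sq_sqrt hδ.le]
  refine le_trans (le_of_eq ?_) (lintegral_inv_mul_indicator_le (u := u) hA hδ)
  rw [← lintegral_indicator (hSm' u)]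
  rfl

theorem volume_reducedCone_le : volume reducedCone ≤ ENNReal.ofReal (Real.pi ^ 2 / 24) := by
  refine volume_reducedCone_le_lintegral.trans ?_
  rw [← lintegral_lintegral_pi_mul_one_sub_sqrt, ← lintegral_indicator measurableSet_Ioi]
  refine lintegral_mono fun A => ?_
  have h0 : ∀ B, ¬ (0 < A ∧ 0 ≤ B ∧ B ≤ A) →
      ∫⁻ a, ∫⁻ b, ENNReal.ofReal (1 / a ^ 2) * hessRegion.indicator 1 ((a, b), (A, B)) = 0 := by
    intro B h
    have : ∀ a b, hessRegion.indicator (1 : (ℝ × ℝ) × ℝ × ℝ → ENNReal) ((a, b), (A, B)) = 0 := fun a b =>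
      Set.indicator_of_notMem (fun hh => h ⟨hh.2.1, hh.2.2.1, hh.2.2.2.1⟩) _
    simp only [this, mul_zero, lintegral_zero]
  by_cases hA : 0 < A
  · rw [Set.indicator_of_mem (Set.mem_Ioi.2 hA), ← lintegral_indicator measurableSet_Icc]
    refine lintegral_mono fun B => ?_
    by_cases hB : 0 ≤ B ∧ B ≤ A
    · rw [Set.indicator_of_mem (Set.mem_Icc.2 hB)]
      exact lintegral_hessRegion_slice_le hA hB.1 hB.2
    · rw [h0 B fun h => hB h.2]
      exact zero_le
  · simp only [h0 _ fun h => hA h.1, lintegral_zero]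
    exact zero_le

theorem volume_reducedRegion_le (R : ℝ) :
    (volume (reducedRegion R)).toReal ≤ Real.pi ^ 2 / 24 := by
  refine ENNReal.toReal_le_of_le_ofReal (by positivity) (le_trans (measure_mono ?_)
    volume_reducedCone_le)
  rintro v ⟨-, -, -, -, h⟩
  exact h

theorem abs_card_filter_mem_sub_le {M : ℕ} [NeZero M] (G : Finset (ZMod M)) (N : ℕ) :
    |(((Finset.range N).filter fun n : ℕ => (n : ZMod M) ∈ G).card : ℝ) - G.card * (N / M)| ≤
      G.card := by
  have hM : 0 < M := NeZero.pos M
  have hmaps : ((Finset.range N).filter fun n : ℕ => (n : ZMod M) ∈ G : Set ℕ).MapsTo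
      (fun n : ℕ => (n : ZMod M)) G := fun n hn => (Finset.mem_filter.1 (Finset.mem_coe.1 hn)).2
  have h1 : ((Finset.range N).filter fun n : ℕ => (n : ZMod M) ∈ G).card =
      ∑ g ∈ G, N.count (· ≡ g.val [MOD M]) := by
    rw [Finset.card_eq_sum_card_fiberwise hmaps]
    refine Finset.sum_congr rfl fun g hg => ?_
    rw [Nat.count_eq_card_filter_range, Finset.filter_filter]
    congr 1
    refine Finset.filter_congr fun n _ => ?_
    rw [← ZMod.natCast_eq_natCast_iff, ZMod.natCast_zmod_val]
    exact ⟨fun h => h.2, fun h => ⟨h ▸ hg, h⟩⟩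
  rw [h1, Nat.cast_sum, ← nsmul_eq_mul, ← Finset.sum_const, ← Finset.sum_sub_distrib]
  refine (Finset.abs_sum_le_sum_abs _ _).trans ?_
  refine (Finset.sum_le_card_nsmul _ _ 1 fun g _ => ?_).trans (by simp)
  rw [Nat.count_modEq_card _ hM]
  have h2 : (N / M : ℝ) = (N / M : ℕ) + ((N % M : ℕ) : ℝ) / M := by
    have hM' : (M : ℝ) ≠ 0 := by positivity
    have := Nat.div_add_mod N M
    rw [div_eq_iff hM', add_mul, div_mul_cancel₀ _ hM']
    exact_mod_cast by rw [mul_comm]; exact this.symm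
  have h3 : ((N % M : ℕ) : ℝ) / M ≤ 1 := by
    rw [div_le_one (by positivity)]
    exact_mod_cast (Nat.mod_lt N hM).le
  have h4 : 0 ≤ ((N % M : ℕ) : ℝ) / M := by positivity
  rw [h2]
  push_cast
  split_ifs
  · rw [abs_le]
    constructor <;> linarith
  · rw [abs_le]
    constructor <;> linarith

theorem exists_abs_card_sifted_sub_le {r : ℕ} (hr : r < 12) {Y : ℕ} (hY : 5 ≤ Y) :
    ∃ K : ℝ, ∀ N : ℕ, |(((Finset.range N).filter fun n : ℕ =>
      n % 12 = r ∧ ∀ p ∈ Y.primesBelow, 5 ≤ p → ¬ p ^ 2 ∣ n).card : ℝ) -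
      1 / 12 * (∏ p ∈ Y.primesBelow.filter (5 ≤ ·), (1 - 1 / (p : ℝ) ^ 2)) * N| ≤ K := by
  classical
  let L : ∀ p, Finset (Unit → ZMod (sieveModulus p)) := fun p => Finset.univ.filter fun w =>
    (p = 2 → w () = (r : ZMod (sieveModulus p))) ∧ (p = 3 → w () = (r : ZMod (sieveModulus p))) ∧
      (5 ≤ p → w () ≠ 0)
  obtain ⟨M, hM, G, hG, hmem⟩ : ∃ M, M = ∏ p ∈ Y.primesBelow, sieveModulus p ∧
      ∃ G : Finset (Unit → ZMod M), G.card = ∏ p ∈ Y.primesBelow, (L p).card ∧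
      ∀ v : Unit → ℤ, (fun k => (v k : ZMod M)) ∈ G ↔
        ∀ p ∈ Y.primesBelow, (fun k => (v k : ZMod (sieveModulus p))) ∈ L p :=
    ⟨_, rfl, card_filter_forall_intCast_mem Y.primesBelow sieveModulus (sieveModulus_coprime Y) L⟩
  have hM0 : M ≠ 0 := by
    rw [hM]
    exact Finset.prod_ne_zero_iff.2 fun p _ => NeZero.ne _
  have : NeZero M := ⟨hM0⟩
  have hs2 : sieveModulus 2 = 4 := by norm_num [sieveModulus, Nat.prime_two]
  have hs3 : sieveModulus 3 = 3 := by norm_num [sieveModulus]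
  have hs5 : ∀ p, p.Prime → 5 ≤ p → sieveModulus p = p ^ 2 := by
    intro p hp hp5
    unfold sieveModulus
    rw [if_neg (by omega), if_pos hp]
  let G' : Finset (ZMod M) := G.map (Equiv.funUnique Unit (ZMod M)).toEmbedding
  have hcard : (G.card : ℝ) / M =
      1 / 12 * ∏ p ∈ Y.primesBelow.filter (5 ≤ ·), (1 - 1 / (p : ℝ) ^ 2) := by
    have l2 : (L 2).card = 1 := by
      refine Finset.card_eq_one.2 ⟨fun _ => r, ?_⟩
      ext w
      simp only [L, Finset.mem_filter, Finset.mem_univ, true_and, Finset.mem_singleton]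
      refine ⟨fun h => funext fun _ => by simpa using h, ?_⟩
      rintro rfl
      simp
    have l3 : (L 3).card = 1 := by
      refine Finset.card_eq_one.2 ⟨fun _ => r, ?_⟩
      ext w
      simp only [L, Finset.mem_filter, Finset.mem_univ, true_and, Finset.mem_singleton]
      refine ⟨fun h => funext fun _ => by simpa using h, ?_⟩
      rintro rfl
      simp
    rw [hG, hM, Nat.cast_prod, Nat.cast_prod, ← Finset.prod_div_distrib,
      filter_primesBelow_prod (f := fun p => ((L p).card / sieveModulus p : ℝ)) hY, l2, l3, hs2, hs3]
    congr 1
    · norm_num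
    · refine Finset.prod_congr rfl fun p hp => ?_
      obtain ⟨hp, hp5⟩ := Finset.mem_filter.1 hp
      have hpp := Nat.prime_of_mem_primesBelow hp
      have : L p = Finset.univ.erase 0 := by
        ext w
        simp only [L, Finset.mem_filter, Finset.mem_univ, true_and, Finset.mem_erase, and_true]
        refine ⟨fun h hw => h.2.2 hp5 (by rw [hw]; rfl), fun h => ⟨by omega, by omega, fun _ hw => ?_⟩⟩
        exact h (funext fun _ => hw)
      have hp0 : (p : ℝ) ≠ 0 := by exact_mod_cast hpp.ne_zero
      rw [this, Finset.card_erase_of_mem (Finset.mem_univ _), Finset.card_univ, Fintype.card_fun,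
        ZMod.card, Fintype.card_unit, pow_one, hs5 p hpp hp5,
        Nat.cast_sub (Nat.one_le_iff_ne_zero.2 (pow_ne_zero _ hpp.ne_zero))]
      push_cast
      field_simp
  refine ⟨G'.card, fun N => ?_⟩
  have key := abs_card_filter_mem_sub_le G' N
  have e1 : (G'.card : ℝ) * (N / M) =
      1 / 12 * (∏ p ∈ Y.primesBelow.filter (5 ≤ ·), (1 - 1 / (p : ℝ) ^ 2)) * N := by
    rw [← hcard, Finset.card_map]
    ring
  rw [e1] at key
  convert key using 5
  refine Finset.filter_congr fun n _ => ?_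
  have h := hmem fun _ => (n : ℤ)
  simp only [Int.cast_natCast] at h
  have e2 : (n : ZMod M) ∈ G' ↔ (fun _ => (n : ZMod M)) ∈ G := by
    rw [Finset.mem_map_equiv]
    rfl
  rw [e2, h]
  have t2 : 2 ∈ Y.primesBelow := Nat.mem_primesBelow.2 ⟨by omega, Nat.prime_two⟩
  have t3 : 3 ∈ Y.primesBelow := Nat.mem_primesBelow.2 ⟨by omega, Nat.prime_three⟩
  simp only [L, Finset.mem_filter, Finset.mem_univ, true_and]
  constructor
  · rintro ⟨h12, h5⟩ p hp
    refine ⟨?_, ?_, fun hp5 => ?_⟩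
    · rintro rfl
      rw [ZMod.natCast_eq_natCast_iff', hs2]
      omega
    · rintro rfl
      rw [ZMod.natCast_eq_natCast_iff', hs3]
      omega
    · rw [Ne, ZMod.natCast_eq_zero_iff, hs5 p (Nat.prime_of_mem_primesBelow hp) hp5]
      exact h5 p hp hp5
  · intro H
    refine ⟨?_, fun p hp hp5 => ?_⟩
    · have a2 := (H 2 t2).1 rfl
      have a3 := (H 3 t3).2.1 rfl
      rw [ZMod.natCast_eq_natCast_iff', hs2] at a2
      rw [ZMod.natCast_eq_natCast_iff', hs3] at a3
      omega
    · have a5 := (H p hp).2.2 hp5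
      rwa [Ne, ZMod.natCast_eq_zero_iff, hs5 p (Nat.prime_of_mem_primesBelow hp) hp5] at a5

theorem card_biUnion_sq_dvd_le {Y : ℕ} (hY : 0 < Y) (N : ℕ) :
    (((Finset.Ioo (Y - 1) N).biUnion fun p => (Finset.Ioc 0 N).filter fun n => p ^ 2 ∣ n).card : ℝ)
      ≤ 2 / Y * N := by
  have h2 : ((Finset.Ioo (Y - 1) N).biUnion fun p =>
      (Finset.Ioc 0 N).filter fun n => p ^ 2 ∣ n).card ≤ _ := Finset.card_biUnion_le
  simp only [Nat.Ioc_filter_dvd_card_eq_div] at h2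
  have h3 : ((∑ p ∈ Finset.Ioo (Y - 1) N, N / p ^ 2 : ℕ) : ℝ) ≤
      N * ∑ p ∈ Finset.Ioo (Y - 1) N, ((p : ℝ) ^ 2)⁻¹ := by
    rw [Nat.cast_sum, Finset.mul_sum]
    refine Finset.sum_le_sum fun p _ => ?_
    rw [← div_eq_mul_inv]
    exact_mod_cast Nat.cast_div_le (α := ℝ) (m := N) (n := p ^ 2)
  have h4 := sum_Ioo_inv_sq_le (α := ℝ) (Y - 1) N
  rw [Nat.cast_sub hY, Nat.cast_one, sub_add_cancel] at h4
  calc _ ≤ ((∑ p ∈ Finset.Ioo (Y - 1) N, N / p ^ 2 : ℕ) : ℝ) := by exact_mod_cast h2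
    _ ≤ _ := h3
    _ ≤ N * (2 / Y) := mul_le_mul_of_nonneg_left h4 (by positivity)
    _ = _ := mul_comm _ _

open Filter Topology in
theorem tendsto_card_squarefree_mod_twelve {r : ℕ} (hr : r < 12) (h4 : r % 4 ≠ 0)
    (h3 : r % 3 ≠ 0) : Tendsto (fun N : ℕ => (((Finset.range N).filter fun n : ℕ =>
      n % 12 = r ∧ Squarefree n).card : ℝ) / N) atTop (𝓝 (3 / (4 * Real.pi ^ 2))) := by
  rw [Metric.tendsto_atTop]
  intro ε hε
  have hprod := (tendsto_prod_one_sub_inv_sq_five_le.const_mul (1 / 12))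
  have e : 1 / 12 * (9 / Real.pi ^ 2) = 3 / (4 * Real.pi ^ 2) := by ring
  rw [e, Metric.tendsto_atTop] at hprod
  obtain ⟨Y₁, hY₁⟩ := hprod (ε / 4) (by positivity)
  obtain ⟨Y₂, hY₂⟩ := exists_nat_gt (8 / ε)
  set Y := max 5 (max Y₁ Y₂) with hYdef
  have hY5 : 5 ≤ Y := le_max_left _ _
  have hY1 := hY₁ Y ((le_max_left _ _).trans (le_max_right _ _))
  have hY2 : 2 / (Y : ℝ) ≤ ε / 4 := by
    have : (Y₂ : ℝ) ≤ Y := by exact_mod_cast (le_max_right _ _).trans (le_max_right _ _)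
    rw [div_le_iff₀ (by positivity)]
    rw [div_lt_iff₀ hε] at hY₂
    nlinarith
  set P := 1 / 12 * ∏ p ∈ Y.primesBelow.filter (5 ≤ ·), (1 - 1 / (p : ℝ) ^ 2) with hP
  obtain ⟨K, hK⟩ := exists_abs_card_sifted_sub_le hr hY5
  obtain ⟨N₀, hN₀⟩ := exists_nat_gt (4 * |K| / ε)
  refine ⟨N₀ + 1, fun N hN => ?_⟩
  have hNpos : (0 : ℝ) < N := by exact_mod_cast (by omega : 0 < N)
  have hKN : K ≤ ε / 4 * N := by
    have : (N₀ : ℝ) ≤ N := by exact_mod_cast (by omega : N₀ ≤ N)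
    rw [div_lt_iff₀ hε] at hN₀
    nlinarith [le_abs_self K]
  set S := (Finset.range N).filter fun n : ℕ => n % 12 = r ∧ Squarefree n with hS
  set T := (Finset.range N).filter fun n : ℕ =>
      n % 12 = r ∧ ∀ p ∈ Y.primesBelow, 5 ≤ p → ¬ p ^ 2 ∣ n with hT
  set U := (Finset.Ioo (Y - 1) N).biUnion fun p => (Finset.Ioc 0 N).filter fun n => p ^ 2 ∣ n
    with hU
  have hST : S ⊆ T := by
    intro n hn
    obtain ⟨hn, h12, hsq⟩ := Finset.mem_filter.1 hn
    refine Finset.mem_filter.2 ⟨hn, h12, fun p hp _ hpn => ?_⟩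
    rw [pow_two] at hpn
    exact (Nat.prime_of_mem_primesBelow hp).not_isUnit (hsq p hpn)
  have hTSU : T ⊆ S ∪ U := by
    intro n hn
    obtain ⟨hn, h12, h5⟩ := Finset.mem_filter.1 hn
    by_cases hsq : Squarefree n
    · exact Finset.mem_union_left _ (Finset.mem_filter.2 ⟨hn, h12, hsq⟩)
    · rw [Nat.squarefree_iff_prime_squarefree] at hsq
      push Not at hsq
      obtain ⟨p, hp, hpn⟩ := hsq
      rw [← pow_two] at hpn
      have hnN := Finset.mem_range.1 hn
      have h0 : 0 < n := by omega
      refine Finset.mem_union_right _ (Finset.mem_biUnion.2 ⟨p, Finset.mem_Ioo.2 ⟨?_,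
        (Nat.le_self_pow two_ne_zero p).trans_lt ((Nat.le_of_dvd h0 hpn).trans_lt hnN)⟩,
        Finset.mem_filter.2 ⟨Finset.mem_Ioc.2 ⟨h0, hnN.le⟩, hpn⟩⟩)
      suffices Y ≤ p by omega
      by_contra! hpY
      refine h5 p (Nat.mem_primesBelow.2 ⟨hpY, hp⟩) ?_ hpn
      by_contra! hp5
      have := hp.two_le
      interval_cases p
      · omega
      · omega
      · exact absurd hp (by norm_num)
  have c1 : (S.card : ℝ) ≤ T.card := by exact_mod_cast Finset.card_le_card hST
  have c2 : (T.card : ℝ) ≤ S.card + U.card := by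
    exact_mod_cast (Finset.card_le_card hTSU).trans (Finset.card_union_le _ _)
  have c3 : (U.card : ℝ) ≤ 2 / Y * N := card_biUnion_sq_dvd_le (by omega) N
  have c4 := abs_le.1 (hK N)
  rw [Real.dist_eq] at hY1 ⊢
  have c5 := abs_lt.1 hY1
  have c6 : 2 / (Y : ℝ) * N ≤ ε / 4 * N := mul_le_mul_of_nonneg_right hY2 hNpos.le
  rw [abs_lt]
  constructor
  · rw [lt_sub_iff_add_lt, lt_div_iff₀ hNpos]
    nlinarith [c4.1, mul_lt_mul_of_pos_right c5.1 hNpos]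
  · rw [sub_lt_iff_lt_add, div_lt_iff₀ hNpos]
    nlinarith [c4.2, mul_lt_mul_of_pos_right c5.2 hNpos]

theorem hessCond_intCast_of_mod_four {E : Finset (ℤ × ℤ)} {a b c d : ℤ}
    (h : ((b * c - a * d) % 4, ((b ^ 2 - a * c) * (c ^ 2 - b * d)) % 4) ∈ E) :
    hessCond E (a : ZMod 4) b c d := by
  refine ⟨_, h, ?_, ?_⟩
  · rw [← Int.cast_mul, ← Int.cast_mul, ← Int.cast_sub]
    exact (ZMod.intCast_mod _ 4).symm
  · have : ((b : ZMod 4) ^ 2 - a * c) * (c ^ 2 - b * d) =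
        (((b ^ 2 - a * c) * (c ^ 2 - b * d) : ℤ) : ZMod 4) := by push_cast; rfl
    rw [this]
    exact (ZMod.intCast_mod _ 4).symm

theorem hessCond_of_mod_four_eq_one {n a b c d : ℤ} (hn : n % 4 = 1)
    (h : hessDisc a b c d = -absDisc n) : hessCond {(0, 1), (2, 2)} (a : ZMod 4) b c d := by
  refine hessCond_intCast_of_mod_four ?_
  rw [absDisc, if_neg (by omega), hessDisc, mul_assoc] at h
  generalize b * c - a * d = B at h ⊢
  generalize (b ^ 2 - a * c) * (c ^ 2 - b * d) = P at h ⊢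
  obtain ⟨B, rfl | rfl⟩ := Int.even_or_odd' B
  · obtain ⟨B, rfl | rfl⟩ := Int.even_or_odd' B
    all_goals
      ring_nf at h
      simp only [Finset.mem_insert, Finset.mem_singleton, Prod.mk.injEq]
      omega
  · ring_nf at h
    omega

theorem hessCond_of_mod_four_eq_two {n a b c d : ℤ} (hn : n % 4 = 2)
    (h : hessDisc a b c d = -absDisc n) : hessCond {(0, 2), (2, 3)} (a : ZMod 4) b c d := by
  refine hessCond_intCast_of_mod_four ?_
  rw [absDisc, if_neg (by omega), hessDisc, mul_assoc] at h
  generalize b * c - a * d = B at h ⊢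
  generalize (b ^ 2 - a * c) * (c ^ 2 - b * d) = P at h ⊢
  obtain ⟨B, rfl | rfl⟩ := Int.even_or_odd' B
  · obtain ⟨B, rfl | rfl⟩ := Int.even_or_odd' B
    all_goals
      ring_nf at h
      simp only [Finset.mem_insert, Finset.mem_singleton, Prod.mk.injEq]
      omega
  · ring_nf at h
    omega

theorem hessCond_of_mod_four_eq_three {n a b c d : ℤ} (hn : n % 4 = 3)
    (h : hessDisc a b c d = -absDisc n) :
    hessCond ({1, 3} ×ˢ {0, 1, 2, 3}) (a : ZMod 4) b c d := by
  refine hessCond_intCast_of_mod_four ?_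
  rw [absDisc, if_pos hn, hessDisc, mul_assoc] at h
  generalize b * c - a * d = B at h ⊢
  generalize (b ^ 2 - a * c) * (c ^ 2 - b * d) = P at h ⊢
  obtain ⟨B, rfl | rfl⟩ := Int.even_or_odd' B
  all_goals
    ring_nf at h
    simp only [Finset.mem_product, Finset.mem_insert, Finset.mem_singleton]
    omega

/-- There is a reduced binary cubic form with positive leading coefficient whose Hessian has
discriminant `-absDisc n`. -/
def HasReducedForm (n : ℤ) : Prop :=
  ∃ a b c d : ℤ, hessDisc a b c d = -absDisc n ∧ 0 < a ∧ 0 ≤ b * c - a * d ∧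
    b * c - a * d ≤ b ^ 2 - a * c ∧ b ^ 2 - a * c ≤ c ^ 2 - b * d

theorem not_sq_dvd_absDisc {n : ℕ} (hn : Squarefree n) {p : ℕ} (hp : p.Prime) (hp5 : 5 ≤ p) :
    ¬ (p : ℤ) ^ 2 ∣ absDisc n := by
  intro h
  have h4 : p ^ 2 ∣ 4 * n := by
    have : absDisc n ∣ ((4 * n : ℕ) : ℤ) := by
      unfold absDisc
      push_cast
      split_ifs
      · exact dvd_mul_left _ _
      · exact dvd_rfl
    exact_mod_cast h.trans this
  have hcop : (p ^ 2).Coprime 4 := by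
    refine Nat.Coprime.pow 2 2 ((Nat.coprime_primes hp Nat.prime_two).2 (by omega))
  have := hcop.dvd_of_dvd_mul_left h4
  rw [pow_two] at this
  exact hp.not_isUnit (hn p this)

theorem card_hasReducedForm_le {E : Finset (ℤ × ℤ)} {k : ℕ}
    (hE : (Finset.univ.filter fun v : ZMod 4 × ZMod 4 × ZMod 4 × ZMod 4 =>
      hessCond E v.1 v.2.1 v.2.2.1 v.2.2.2).card = k) {r : ℤ}
    (hr : ∀ n : ℤ, n % 4 = r → ∀ a b c d : ℤ, hessDisc a b c d = -absDisc n →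
      hessCond E (a : ZMod 4) b c d) {ε : ℝ} (hε : 0 < ε) :
    ∃ X₀ : ℝ, 0 < X₀ ∧ ∀ X : ℝ, X₀ ≤ X → ∀ B : Finset ℕ,
      (∀ n ∈ B, n % 3 = 1 ∧ (n : ℤ) % 4 = r ∧ Squarefree n ∧ (absDisc n : ℝ) ≤ X ∧
        HasReducedForm n) →
      (B.card : ℝ) ≤ (k / 256 / Real.pi ^ 2 + ε) * X := by
  classical
  obtain ⟨T₀, hT₀, H⟩ := card_reduced_sieved_forms_le volume_reducedRegion_le E hE hε
  refine ⟨T₀ ^ 4, by positivity, fun X hX B hB => ?_⟩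
  have hX0 : 0 < X := lt_of_lt_of_le (by positivity) hX
  obtain ⟨T, hT, rfl⟩ : ∃ T, T₀ ≤ T ∧ T ^ 4 = X := by
    have e : √√X ^ 4 = X := by
      rw [show 4 = 2 * 2 from rfl, pow_mul, Real.sq_sqrt (Real.sqrt_nonneg _),
        Real.sq_sqrt hX0.le]
    refine ⟨√√X, ?_, e⟩
    rw [← e] at hX
    exact le_of_pow_le_pow_left₀ four_ne_zero (Real.sqrt_nonneg _) hX
  have hform : ∀ n ∈ B, ∃ v : ℤ × ℤ × ℤ × ℤ, hessDisc v.1 v.2.1 v.2.2.1 v.2.2.2 = -absDisc n ∧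
      IsReducedForm (T ^ 4) v := by
    intro n hn
    obtain ⟨h3, -, -, hle, a, b, c, d, h, h1, h2, h3, h4⟩ := hB n hn
    refine ⟨(a, b, c, d), h, h1, h2, h3, h4, ?_, ?_⟩
    · dsimp only
      rw [h]
      unfold absDisc
      split_ifs <;> omega
    · have : -(hessDisc (a : ℝ) b c d) = absDisc n := by
        have : hessDisc (a : ℝ) b c d = (hessDisc a b c d : ℤ) := by simp [hessDisc]
        rw [this, h]
        simp
      dsimp only
      linarith
  choose! f hf using hform
  have hinj : Set.InjOn f B := by
    intro n hn m hm hnm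
    have h1 := (hf n hn).1
    rw [hnm, (hf m hm).1] at h1
    have hn4 := (hB n hn).2.1
    have hm4 := (hB m hm).2.1
    unfold absDisc at h1
    split_ifs at h1 <;> omega
  have hS : ∀ v ∈ B.image f, ∃ n ∈ B, f n = v := fun v hv => Finset.mem_image.1 hv
  rw [← Finset.card_image_of_injOn hinj]
  refine (H T hT (B.image f) ?_ ?_ ?_ ?_).trans (le_of_eq ?_)
  · intro v hv
    obtain ⟨n, hn, rfl⟩ := hS v hv
    exact (hf n hn).2
  · intro v hv
    obtain ⟨n, hn, rfl⟩ := hS v hv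
    exact hr n (hB n hn).2.1 _ _ _ _ (hf n hn).1
  · intro v hv
    obtain ⟨n, hn, rfl⟩ := hS v hv
    rw [(hf n hn).1]
    have := (hB n hn).1
    unfold absDisc
    split_ifs <;> omega
  · intro v hv p hp hp5
    obtain ⟨n, hn, rfl⟩ := hS v hv
    rw [(hf n hn).1, dvd_neg]
    exact not_sq_dvd_absDisc (hB n hn).2.2.1 hp hp5
  · congr 2
    have := Real.pi_ne_zero
    field_simp
    ring

/-- The squarefree positive integers below `z` that are congruent to `r` modulo `12`. -/
noncomputable def squarefreeBelow (r : ℕ) (z : ℝ) : Finset ℕ :=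
  (Finset.range ⌈z⌉₊).filter fun n => n % 12 = r ∧ Squarefree n

theorem mem_squarefreeBelow {r : ℕ} {z : ℝ} {n : ℕ} :
    n ∈ squarefreeBelow r z ↔ (n : ℝ) < z ∧ n % 12 = r ∧ Squarefree n := by
  rw [squarefreeBelow, Finset.mem_filter, Finset.mem_range, Nat.lt_ceil]

open Filter Topology in
theorem eventually_abs_card_squarefreeBelow_sub_le {r : ℕ} (hr : r < 12) (h4 : r % 4 ≠ 0)
    (h3 : r % 3 ≠ 0) {ε : ℝ} (hε : 0 < ε) :
    ∀ᶠ z : ℝ in atTop,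
      |((squarefreeBelow r z).card : ℝ) - 3 / (4 * Real.pi ^ 2) * z| ≤ ε * z := by
  have h1 := (tendsto_card_squarefree_mod_twelve hr h4 h3).comp
    (tendsto_nat_ceil_atTop (α := ℝ))
  have h2 := h1.mul (tendsto_nat_ceil_div_atTop (R := ℝ))
  rw [mul_one, Metric.tendsto_nhds] at h2
  filter_upwards [h2 ε hε, eventually_gt_atTop 0] with z hz hz0
  have hc : ((⌈z⌉₊ : ℕ) : ℝ) ≠ 0 := by
    exact_mod_cast (Nat.ceil_pos.2 hz0).ne'
  have e : ((fun N : ℕ => (((Finset.range N).filter fun n : ℕ =>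
      n % 12 = r ∧ Squarefree n).card : ℝ) / N) ∘ fun x : ℝ => ⌈x⌉₊) z * (⌈z⌉₊ / z) =
      (squarefreeBelow r z).card / z := by
    simp only [Function.comp, squarefreeBelow]
    field_simp
  rw [e, Real.dist_eq] at hz
  have : ((squarefreeBelow r z).card : ℝ) - 3 / (4 * Real.pi ^ 2) * z =
      ((squarefreeBelow r z).card / z - 3 / (4 * Real.pi ^ 2)) * z := by
    field_simp
  rw [this, abs_mul, abs_of_pos hz0]
  exact mul_le_mul_of_nonneg_right hz.le hz0.le

open Classical in
theorem card_filter_hasReducedForm_le {E : Finset (ℤ × ℤ)} {k : ℕ}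
    (hE : (Finset.univ.filter fun v : ZMod 4 × ZMod 4 × ZMod 4 × ZMod 4 =>
      hessCond E v.1 v.2.1 v.2.2.1 v.2.2.2).card = k) {r : ℕ} (hr3 : r % 3 = 1)
    (hr : ∀ n : ℤ, n % 4 = (r % 4 : ℕ) → ∀ a b c d : ℤ, hessDisc a b c d = -absDisc n →
      hessCond E (a : ZMod 4) b c d) {s t : ℝ} (ht : 0 < t)
    (hst : ∀ n : ℕ, n % 12 = r → ∀ x : ℝ, (n : ℝ) < s * x → (absDisc n : ℝ) ≤ t * x)
    {ε : ℝ} (hε : 0 < ε) : ∀ᶠ x : ℝ in Filter.atTop,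
      (((squarefreeBelow r (s * x)).filter fun n : ℕ => HasReducedForm n).card : ℝ) ≤
        (k / 256 / Real.pi ^ 2 + ε) * (t * x) := by
  obtain ⟨X₀, hX₀, H⟩ := card_hasReducedForm_le hE hr hε
  filter_upwards [Filter.eventually_ge_atTop (X₀ / t)] with x hx
  rw [div_le_iff₀ ht, mul_comm] at hx
  refine H _ hx _ fun n hn => ?_
  obtain ⟨hn, hform⟩ := Finset.mem_filter.1 hn
  obtain ⟨hlt, h12, hsq⟩ := mem_squarefreeBelow.1 hn
  exact ⟨by omega, by omega, hsq, hst n h12 x hlt, hform⟩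

theorem hasReducedForm_of_three_dvd {c : ℂ} {D : ℤ} {n : ℕ} (hn : Squarefree n)
    (hDn : D = n ∨ D = 4 * n) (hc : c ^ 2 = -(D : ℂ)) (inst : NumberField ℚ⟮c⟯)
    (h3 : 3 ∣ @NumberField.classNumber ℚ⟮c⟯ _ inst) : HasReducedForm n :=
  exists_reduced_form_of_three_dvd (by exact_mod_cast Nat.pos_of_ne_zero hn.ne_zero)
    (Int.squarefree_natCast.2 hn) hDn hc h3

theorem card_image_natCast_mul {k : ℤ} (hk : k ≠ 0) (A : Finset ℕ) :
    (A.image fun n : ℕ => k * n).card = A.card :=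
  Finset.card_image_of_injective _ fun a b h => by simpa [hk] using h

theorem ncard_negative_fundamentalDiscriminants_le (x : ℝ) :
    ({D' : ℤ | IsFundamentalDiscriminant D' ∧ -x < (D' : ℝ) ∧ D' < 0 ∧ D' % 3 = 1} :
      Set ℤ).ncard ≤ (squarefreeBelow 11 (1 * x)).card + (squarefreeBelow 5 (1 / 4 * x)).card +
        (squarefreeBelow 2 (1 / 4 * x)).card := by
  classical
  set S := (squarefreeBelow 11 (1 * x)).image (fun n : ℕ => (-1 : ℤ) * n) ∪
    (squarefreeBelow 5 (1 / 4 * x)).image (fun n : ℕ => (-4 : ℤ) * n) ∪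
    (squarefreeBelow 2 (1 / 4 * x)).image (fun n : ℕ => (-4 : ℤ) * n) with hS
  have hcard : S.card ≤ (squarefreeBelow 11 (1 * x)).card +
      (squarefreeBelow 5 (1 / 4 * x)).card + (squarefreeBelow 2 (1 / 4 * x)).card := by
    refine (Finset.card_union_le _ _).trans (add_le_add ((Finset.card_union_le _ _).trans
      (add_le_add ?_ ?_)) ?_) <;> exact Finset.card_image_le
  refine le_trans ?_ hcard
  rw [← Set.ncard_coe_finset]
  refine Set.ncard_le_ncard ?_ S.finite_toSet
  rintro D ⟨hD, hx, h0, h3⟩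
  rw [hS, Finset.coe_union, Finset.coe_union, Finset.coe_image, Finset.coe_image, Finset.coe_image]
  rcases hD with ⟨h4, hsq⟩ | ⟨m, rfl, hsq, h4⟩
  · left; left
    have hn : ((D.natAbs : ℕ) : ℤ) = -D := by omega
    refine ⟨D.natAbs, mem_squarefreeBelow.2 ⟨?_, by omega, Int.squarefree_natAbs.2 hsq⟩, ?_⟩
    · have : ((D.natAbs : ℕ) : ℝ) = -D := by
        rw [← Int.cast_natCast, hn, Int.cast_neg]
      linarith
    · dsimp only
      omega
  · have hn : ((m.natAbs : ℕ) : ℤ) = -m := by omega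
    have hlt : ((m.natAbs : ℕ) : ℝ) < 1 / 4 * x := by
      have : ((m.natAbs : ℕ) : ℝ) = -m := by
        rw [← Int.cast_natCast, hn, Int.cast_neg]
      push_cast at hx
      linarith
    rcases h4 with h4 | h4
    · right
      refine ⟨m.natAbs, mem_squarefreeBelow.2 ⟨hlt, by omega, Int.squarefree_natAbs.2 hsq⟩, ?_⟩
      dsimp only
      omega
    · left; right
      refine ⟨m.natAbs, mem_squarefreeBelow.2 ⟨hlt, by omega, Int.squarefree_natAbs.2 hsq⟩, ?_⟩
      dsimp only
      omega

open Classical in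
theorem le_ncard_not_three_dvd_classNumber (x : ℝ) :
    ((squarefreeBelow 1 (1 * x)).filter fun n : ℕ => ¬ HasReducedForm n).card +
      ((squarefreeBelow 7 (1 / 4 * x)).filter fun n : ℕ => ¬ HasReducedForm n).card +
      ((squarefreeBelow 10 (1 / 4 * x)).filter fun n : ℕ => ¬ HasReducedForm n).card ≤
    ({D : ℤ | IsFundamentalDiscriminant D ∧ 0 < D ∧ (D : ℝ) < x ∧ D % 3 = 1 ∧
      ∀ c : ℂ, c ^ 2 = -(D : ℂ) → ∀ inst : NumberField ℚ⟮c⟯,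
        ¬ (3 ∣ @NumberField.classNumber ℚ⟮c⟯ _ inst)} : Set ℤ).ncard := by
  rw [← card_image_natCast_mul one_ne_zero ((squarefreeBelow 1 (1 * x)).filter _),
    ← card_image_natCast_mul four_ne_zero ((squarefreeBelow 7 (1 / 4 * x)).filter _),
    ← card_image_natCast_mul four_ne_zero ((squarefreeBelow 10 (1 / 4 * x)).filter _)]
  have hfin : ({D : ℤ | IsFundamentalDiscriminant D ∧ 0 < D ∧ (D : ℝ) < x ∧ D % 3 = 1 ∧
      ∀ c : ℂ, c ^ 2 = -(D : ℂ) → ∀ inst : NumberField ℚ⟮c⟯,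
        ¬ (3 ∣ @NumberField.classNumber ℚ⟮c⟯ _ inst)} : Set ℤ).Finite := by
    refine (Set.finite_Ioo (0 : ℤ) ⌈x⌉).subset fun D hD => ⟨hD.2.1, ?_⟩
    exact Int.lt_ceil.2 hD.2.2.1
  have hsub : ∀ D : ℤ, ∀ n : ℕ, ¬ HasReducedForm n → Squarefree n → (D = n ∨ D = 4 * n) →
      IsFundamentalDiscriminant D → (D : ℝ) < x → D % 3 = 1 →
      D ∈ {D : ℤ | IsFundamentalDiscriminant D ∧ 0 < D ∧ (D : ℝ) < x ∧ D % 3 = 1 ∧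
        ∀ c : ℂ, c ^ 2 = -(D : ℂ) → ∀ inst : NumberField ℚ⟮c⟯,
          ¬ (3 ∣ @NumberField.classNumber ℚ⟮c⟯ _ inst)} := by
    intro D n hform hsq hDn hfund hx h3
    have := Nat.pos_of_ne_zero hsq.ne_zero
    exact ⟨hfund, by omega, hx, h3, fun c hc inst h =>
      hform (hasReducedForm_of_three_dvd hsq hDn hc inst h)⟩
  rw [← Finset.card_union_of_disjoint, ← Finset.card_union_of_disjoint, ← Set.ncard_coe_finset]
  · refine Set.ncard_le_ncard (fun D hD => ?_) hfin
    rw [Finset.mem_coe, Finset.mem_union, Finset.mem_union, Finset.mem_image, Finset.mem_image,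
      Finset.mem_image] at hD
    obtain (⟨n, hn, rfl⟩ | ⟨n, hn, rfl⟩) | ⟨n, hn, rfl⟩ := hD
    all_goals
      obtain ⟨hn, hform⟩ := Finset.mem_filter.1 hn
      obtain ⟨hlt, h12, hsq⟩ := mem_squarefreeBelow.1 hn
    · refine hsub _ n hform hsq (Or.inl (one_mul _)) (Or.inl ⟨by omega, ?_⟩) ?_ (by omega)
      · rw [one_mul]
        exact Int.squarefree_natCast.2 hsq
      · push_cast
        linarith
    · refine hsub _ n hform hsq (Or.inr rfl)
        (Or.inr ⟨n, rfl, Int.squarefree_natCast.2 hsq, by omega⟩) ?_ (by omega)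
      push_cast
      linarith
    · refine hsub _ n hform hsq (Or.inr rfl)
        (Or.inr ⟨n, rfl, Int.squarefree_natCast.2 hsq, by omega⟩) ?_ (by omega)
      push_cast
      linarith
  · rw [Finset.disjoint_left]
    intro D h1 h2
    rw [Finset.mem_union, Finset.mem_image, Finset.mem_image] at h1
    obtain ⟨m, hm, rfl⟩ := Finset.mem_image.1 h2
    have := (mem_squarefreeBelow.1 (Finset.mem_filter.1 hm).1).2.1
    obtain ⟨n, hn, h⟩ | ⟨n, hn, h⟩ := h1
    all_goals
      have := (mem_squarefreeBelow.1 (Finset.mem_filter.1 hn).1).2.1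
      omega
  · rw [Finset.disjoint_left]
    intro D h1 h2
    obtain ⟨m, hm, rfl⟩ := Finset.mem_image.1 h2
    have := (mem_squarefreeBelow.1 (Finset.mem_filter.1 hm).1).2.1
    obtain ⟨n, hn, h⟩ := Finset.mem_image.1 h1
    have := (mem_squarefreeBelow.1 (Finset.mem_filter.1 hn).1).2.1
    omega

end

theorem class_number_indivisibility_relative_density (ε : ℝ) (hε : 0 < ε) :
    ∃ x₀ : ℝ, 0 < x₀ ∧ ∀ x : ℝ, x₀ ≤ x →
      (1 / 2 - ε) *
          (({D' : ℤ | IsFundamentalDiscriminant D' ∧ -x < (D' : ℝ) ∧ D' < 0 ∧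
            D' % 3 = 1} : Set ℤ).ncard : ℝ) ≤
        (({D : ℤ | IsFundamentalDiscriminant D ∧ 0 < D ∧ (D : ℝ) < x ∧ D % 3 = 1 ∧
          ∀ c : ℂ, c ^ 2 = -(D : ℂ) →
            ∀ inst : NumberField ℚ⟮c⟯,
              ¬ (3 ∣ @NumberField.classNumber ℚ⟮c⟯ _ inst)} : Set ℤ).ncard : ℝ) := by
  classical
  rcases le_or_gt (1 / 2 - ε) 0 with hε2 | hε2
  · exact ⟨1, one_pos, fun x _ => (mul_nonpos_of_nonpos_of_nonneg hε2 (Nat.cast_nonneg _)).trans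
      (Nat.cast_nonneg _)⟩
  set κ := 1 / Real.pi ^ 2 with hκ
  have hκ0 : 0 < κ := by positivity
  set η := ε * κ / 20 with hη
  have hη0 : 0 < η := by positivity
  have hcount : ∀ r < 12, r % 4 ≠ 0 → r % 3 ≠ 0 → ∀ s : ℝ, 0 < s → ∀ᶠ x : ℝ in Filter.atTop,
      |((squarefreeBelow r (s * x)).card : ℝ) - 3 / 4 * κ * (s * x)| ≤ η * (s * x) := by
    intro r hr h4 h3 s hs
    have h := (Filter.tendsto_id.const_mul_atTop hs).eventually
      (eventually_abs_card_squarefreeBelow_sub_le hr h4 h3 hη0)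
    have e : 3 / 4 * κ = 3 / (4 * Real.pi ^ 2) := by rw [hκ]; ring
    rw [e]
    exact h
  have b1 := card_filter_hasReducedForm_le card_four_fam_one (r := 1) (by norm_num)
    (fun n hn a b c d h => hessCond_of_mod_four_eq_one (by omega) h) (s := 1) (t := 4)
    (by norm_num) (fun n hn x hx => by
      rw [absDisc, if_neg (by omega)]
      push_cast
      linarith) hη0
  have b2 := card_filter_hasReducedForm_le card_four_fam_two (r := 7) (by norm_num)
    (fun n hn a b c d h => hessCond_of_mod_four_eq_three (by omega) h) (s := 1 / 4) (t := 1 / 4)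
    (by norm_num) (fun n hn x hx => by
      rw [absDisc, if_pos (by omega)]
      push_cast
      linarith) hη0
  have b3 := card_filter_hasReducedForm_le card_four_fam_three (r := 10) (by norm_num)
    (fun n hn a b c d h => hessCond_of_mod_four_eq_two (by omega) h)
    (s := 1 / 4) (t := 1) (by norm_num) (fun n hn x hx => by
      rw [absDisc, if_neg (by omega)]
      push_cast
      linarith) hη0
  have hev := (hcount 1 (by norm_num) (by norm_num) (by norm_num) 1 (by norm_num)).and <|
    (hcount 7 (by norm_num) (by norm_num) (by norm_num) (1 / 4) (by norm_num)).and <|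
    (hcount 10 (by norm_num) (by norm_num) (by norm_num) (1 / 4) (by norm_num)).and <|
    (hcount 11 (by norm_num) (by norm_num) (by norm_num) 1 (by norm_num)).and <|
    (hcount 5 (by norm_num) (by norm_num) (by norm_num) (1 / 4) (by norm_num)).and <|
    (hcount 2 (by norm_num) (by norm_num) (by norm_num) (1 / 4) (by norm_num)).and <|
    b1.and (b2.and b3)
  obtain ⟨x₁, hx₁⟩ := Filter.eventually_atTop.1 hev
  refine ⟨max 1 x₁, by positivity, fun x hx => ?_⟩
  have hx0 : 0 < x := one_pos.trans_le ((le_max_left _ _).trans hx)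
  obtain ⟨a1, a7, a10, a11, a5, a2, b1, b2, b3⟩ := hx₁ x ((le_max_right _ _).trans hx)
  have hneg : (({D' : ℤ | IsFundamentalDiscriminant D' ∧ -x < (D' : ℝ) ∧ D' < 0 ∧
      D' % 3 = 1} : Set ℤ).ncard : ℝ) ≤ (9 / 8 * κ + 3 / 2 * η) * x := by
    have h : (({D' : ℤ | IsFundamentalDiscriminant D' ∧ -x < (D' : ℝ) ∧ D' < 0 ∧
      D' % 3 = 1} : Set ℤ).ncard : ℝ) ≤ _ :=
      Nat.cast_le.2 (ncard_negative_fundamentalDiscriminants_le x)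
    push_cast at h
    linarith [(abs_le.1 a11).2, (abs_le.1 a5).2, (abs_le.1 a2).2]
  have hpos := Nat.cast_le (α := ℝ).2 (le_ncard_not_three_dvd_classNumber x)
  push_cast at hpos
  have hsplit : ∀ A : Finset ℕ, ((A.filter fun n : ℕ => HasReducedForm n).card : ℝ) +
      ((A.filter fun n : ℕ => ¬ HasReducedForm n).card : ℝ) = A.card := fun A => by
    exact_mod_cast Finset.card_filter_add_card_filter_not _
  have s1 := hsplit (squarefreeBelow 1 (1 * x))
  have s7 := hsplit (squarefreeBelow 7 (1 / 4 * x))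
  have s10 := hsplit (squarefreeBelow 10 (1 / 4 * x))
  have e1 : (24 : ℕ) / 256 / Real.pi ^ 2 = 3 / 32 * κ := by rw [hκ]; push_cast; ring
  have e2 : (96 : ℕ) / 256 / Real.pi ^ 2 = 3 / 8 * κ := by rw [hκ]; push_cast; ring
  rw [e1] at b1 b3
  rw [e2] at b2
  have hgood : (9 / 16 * κ - 27 / 4 * η) * x ≤
      (({D : ℤ | IsFundamentalDiscriminant D ∧ 0 < D ∧ (D : ℝ) < x ∧ D % 3 = 1 ∧
          ∀ c : ℂ, c ^ 2 = -(D : ℂ) →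
            ∀ inst : NumberField ℚ⟮c⟯,
              ¬ (3 ∣ @NumberField.classNumber ℚ⟮c⟯ _ inst)} : Set ℤ).ncard : ℝ) := by
    refine le_trans ?_ hpos
    linarith [(abs_le.1 a1).1, (abs_le.1 a7).1, (abs_le.1 a10).1]
  refine (mul_le_mul_of_nonneg_left hneg hε2.le).trans (le_trans ?_ hgood)
  rw [← mul_assoc]
  refine mul_le_mul_of_nonneg_right ?_ hx0.le
  have h1 : ε * κ = 20 * η := by rw [hη]; ring
  have h2 : 0 < ε * η := by positivity
  linarith
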